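/- Let p ≥ 2, f ∈ ℝⁿ, ξ ∼ N(0, σ²I_{n×n}), y = f + ξ. Assume the diagonal elements of (1/n)𝕏ᵀ𝕏 are at most 1, and let λ ≥ 2σ√(2 log(p)/n). Let β̂ be any solution of the LASSO problem min_{β∈ℝᵖ}( ‖y − 𝕏β‖² + 2λ|β|₁ ). Then for any δ ∈ (0,1), with probability at least 1 − δ, ‖𝕏β̂ − f‖ ≤ min over S ⊆ {1,…,p} of [ min_{β: supp(β)=S} ‖𝕏β − f‖ + 3λ√|S|/(2κ(S,3)) ] + σΦ⁻¹(1−δ)/√n, with the convention a/0 = +∞ for a > 0. -/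

import Mathlib

open MeasureTheory ProbabilityTheory
open scoped ENNReal

/-- The scaled Euclidean norm `‖u‖ = sqrt((1/n) ∑ u_i²)` on `ℝⁿ`. -/
noncomputable def scaledNorm {n : ℕ} (u : Fin n → ℝ) : ℝ :=
  Real.sqrt ((∑ i, u i ^ 2) / n)

/-- The standard normal cumulative distribution function `Φ`. -/
noncomputable def stdPhi (t : ℝ) : ℝ :=
  (gaussianReal 0 1 (Set.Iic t)).toReal

/-- The Gaussian measure `N(0, σ²I_{n×n})` on `ℝⁿ` (i.i.d. `N(0,σ²)` components). -/
noncomputable def gaussianVec (n : ℕ) (σ : ℝ) : Measure (Fin n → ℝ) :=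
  Measure.pi fun _ : Fin n => gaussianReal 0 ⟨σ ^ 2, sq_nonneg σ⟩

/-- The squared Restricted Eigenvalue constant
`κ²(S,c₀) = min { ‖XΔ‖²/|Δ|₂² : Δ ≠ 0, |Δ_{Sᶜ}|₁ ≤ c₀ |Δ_S|₁ }`. -/
noncomputable def kappaSq {n p : ℕ} (X : Matrix (Fin n) (Fin p) ℝ)
    (S : Finset (Fin p)) (c₀ : ℝ) : ℝ :=
  sInf {r | ∃ Δ : Fin p → ℝ, Δ ≠ 0 ∧ (∑ j ∈ Sᶜ, |Δ j|) ≤ c₀ * ∑ j ∈ S, |Δ j| ∧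
    r = scaledNorm (X.mulVec Δ) ^ 2 / ∑ j, Δ j ^ 2}

open Filter Topology Set

/-- The standard normal density. -/
noncomputable def stdPdf (t : ℝ) : ℝ := (Real.sqrt (2 * Real.pi))⁻¹ * Real.exp (-(t ^ 2) / 2)

lemma gaussianPDFReal_zero_one : gaussianPDFReal 0 1 = stdPdf := by
  ext t
  simp [gaussianPDFReal, stdPdf]

lemma stdPdf_pos (t : ℝ) : 0 < stdPdf t := by unfold stdPdf; positivity

lemma contDiff_stdPdf {k : ℕ∞} : ContDiff ℝ k stdPdf := by unfold stdPdf; fun_prop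

lemma continuous_stdPdf : Continuous stdPdf := (contDiff_stdPdf (k := 0)).continuous

lemma stdPdf_neg (t : ℝ) : stdPdf (-t) = stdPdf t := by simp [stdPdf]

lemma hasDerivAt_stdPdf (t : ℝ) : HasDerivAt stdPdf (-t * stdPdf t) t := by
  have h : HasDerivAt (fun t : ℝ => -(t ^ 2) / 2) (-t) t := by
    have := ((hasDerivAt_pow 2 t).neg).div_const 2
    refine this.congr_deriv ?_
    norm_num
    ring
  refine (h.exp.const_mul (Real.sqrt (2 * Real.pi))⁻¹).congr_deriv ?_
  simp only [stdPdf]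
  ring

lemma integrable_stdPdf : Integrable stdPdf :=
  gaussianPDFReal_zero_one ▸ integrable_gaussianPDFReal 0 1

lemma gaussianReal_real_apply (s : Set ℝ) : (gaussianReal 0 1).real s = ∫ t in s, stdPdf t := by
  rw [Measure.real, gaussianReal_apply_eq_integral 0 one_ne_zero, gaussianPDFReal_zero_one,
    ENNReal.toReal_ofReal]
  exact integral_nonneg fun t => (stdPdf_pos t).le

lemma stdPhi_eq_integral (t : ℝ) : stdPhi t = ∫ s in Iic t, stdPdf s :=
  gaussianReal_real_apply _

lemma hasDerivAt_integral_Iic {f : ℝ → ℝ} (hf : Integrable f) (hc : Continuous f) (t : ℝ) :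
    HasDerivAt (fun t => ∫ s in Iic t, f s) (f t) t := by
  have h : (fun t => ∫ s in Iic t, f s) = fun t => (∫ s in Iic 0, f s) + ∫ s in (0 : ℝ)..t, f s := by
    ext t
    rw [← intervalIntegral.integral_Iic_sub_Iic hf.integrableOn hf.integrableOn]
    ring
  rw [h]
  exact (intervalIntegral.integral_hasDerivAt_right (hc.intervalIntegrable _ _)
    hc.aestronglyMeasurable.stronglyMeasurableAtFilter hc.continuousAt).const_add _

lemma hasDerivAt_stdPhi (t : ℝ) : HasDerivAt stdPhi (stdPdf t) t := by
  rw [funext stdPhi_eq_integral]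
  exact hasDerivAt_integral_Iic integrable_stdPdf continuous_stdPdf t

lemma continuous_stdPhi : Continuous stdPhi :=
  continuous_iff_continuousAt.2 fun t => (hasDerivAt_stdPhi t).continuousAt

lemma strictMono_stdPhi : StrictMono stdPhi :=
  strictMono_of_deriv_pos fun t => by rw [(hasDerivAt_stdPhi t).deriv]; exact stdPdf_pos t

lemma stdPhi_eq_cdf : stdPhi = fun t => cdf (gaussianReal 0 1) t := by
  ext t
  rw [cdf_eq_real]
  rfl

lemma tendsto_stdPhi_atBot : Tendsto stdPhi atBot (𝓝 0) := by
  rw [stdPhi_eq_cdf]; exact tendsto_cdf_atBot _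

lemma tendsto_stdPhi_atTop : Tendsto stdPhi atTop (𝓝 1) := by
  rw [stdPhi_eq_cdf]; exact tendsto_cdf_atTop _

lemma stdPhi_pos (t : ℝ) : 0 < stdPhi t := by
  have h := strictMono_stdPhi (sub_one_lt t)
  exact lt_of_le_of_lt ENNReal.toReal_nonneg h

lemma stdPhi_lt_one (t : ℝ) : stdPhi t < 1 :=
  lt_of_lt_of_le (strictMono_stdPhi (lt_add_one t)) measureReal_le_one

lemma stdPhi_nonneg (t : ℝ) : 0 ≤ stdPhi t := (stdPhi_pos t).le

lemma stdPhi_le_one (t : ℝ) : stdPhi t ≤ 1 := (stdPhi_lt_one t).le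

lemma stdPhi_neg (t : ℝ) : stdPhi (-t) = 1 - stdPhi t := by
  have h1 : stdPhi (-t) = ∫ s in Ioi t, stdPdf s := by
    rw [stdPhi_eq_integral, ← integral_comp_neg_Ioi]
    simp [stdPdf_neg]
  have h2 : stdPhi t + ∫ s in Ioi t, stdPdf s = 1 := by
    rw [stdPhi_eq_integral, ← compl_Iic, integral_add_compl measurableSet_Iic integrable_stdPdf,
      ← gaussianPDFReal_zero_one, integral_gaussianPDFReal_eq_one 0 one_ne_zero]
  linarith

lemma stdPhi_zero : stdPhi 0 = 1 / 2 := by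
  have h := stdPhi_neg 0
  rw [neg_zero] at h
  linarith

lemma exists_stdPhi_eq {x : ℝ} (hx : x ∈ Ioo (0 : ℝ) 1) : ∃ t, stdPhi t = x :=
  mem_range_of_exists_le_of_exists_ge continuous_stdPhi
    ((tendsto_stdPhi_atBot.eventually (gt_mem_nhds hx.1)).exists.imp fun _ h => h.le)
    ((tendsto_stdPhi_atTop.eventually (lt_mem_nhds hx.2)).exists.imp fun _ h => h.le)

/-- The quantile function of the standard normal distribution. -/
noncomputable def stdQuantile : ℝ → ℝ := Function.invFun stdPhi

lemma stdPhi_stdQuantile {x : ℝ} (hx : x ∈ Ioo (0 : ℝ) 1) : stdPhi (stdQuantile x) = x :=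
  Function.invFun_eq (exists_stdPhi_eq hx)

lemma stdQuantile_stdPhi (t : ℝ) : stdQuantile (stdPhi t) = t :=
  Function.leftInverse_invFun strictMono_stdPhi.injective t

lemma strictMonoOn_stdQuantile : StrictMonoOn stdQuantile (Ioo 0 1) := fun x hx y hy h => by
  rw [← strictMono_stdPhi.lt_iff_lt, stdPhi_stdQuantile hx, stdPhi_stdQuantile hy]
  exact h

lemma continuousAt_stdQuantile {x : ℝ} (hx : x ∈ Ioo (0 : ℝ) 1) : ContinuousAt stdQuantile x := by
  refine strictMonoOn_stdQuantile.continuousAt_of_image_mem_nhds (Ioo_mem_nhds hx.1 hx.2) ?_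
  convert univ_mem
  exact eq_univ_of_forall fun t => ⟨stdPhi t, ⟨stdPhi_pos t, stdPhi_lt_one t⟩, stdQuantile_stdPhi t⟩

lemma hasDerivAt_stdQuantile {x : ℝ} (hx : x ∈ Ioo (0 : ℝ) 1) :
    HasDerivAt stdQuantile (stdPdf (stdQuantile x))⁻¹ x :=
  (hasDerivAt_stdPhi _).of_local_left_inverse (continuousAt_stdQuantile hx) (stdPdf_pos _).ne'
    (eventually_of_mem (Ioo_mem_nhds hx.1 hx.2) fun _ => stdPhi_stdQuantile)

/-- The distribution function of a pair of standard normal variables with correlation `-ρ`,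
where `c = √(1 - ρ²)`. -/
noncomputable def biPhi (ρ c a b : ℝ) : ℝ := ∫ s in Iic a, stdPdf s * stdPhi ((b + ρ * s) / c)

lemma stdPdf_mul_stdPdf_comm {ρ c : ℝ} (hc : 0 < c) (h : ρ ^ 2 + c ^ 2 = 1) (a b : ℝ) :
    stdPdf a * stdPdf ((b + ρ * a) / c) = stdPdf b * stdPdf ((a + ρ * b) / c) := by
  have e : -(a ^ 2) / 2 + -(((b + ρ * a) / c) ^ 2) / 2
      = -(b ^ 2) / 2 + -(((a + ρ * b) / c) ^ 2) / 2 := by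
    field_simp
    linear_combination (b ^ 2 - a ^ 2) * h
  have := congrArg Real.exp e
  rw [Real.exp_add, Real.exp_add] at this
  simp only [stdPdf]
  linear_combination (Real.sqrt (2 * Real.pi))⁻¹ ^ 2 * this

lemma stdPdf_le_one (t : ℝ) : stdPdf t ≤ 1 := by
  unfold stdPdf
  have h1 : (Real.sqrt (2 * Real.pi))⁻¹ ≤ 1 := by
    apply inv_le_one_of_one_le₀
    rw [Real.one_le_sqrt]
    nlinarith [Real.pi_gt_three]
  have h2 : Real.exp (-(t ^ 2) / 2) ≤ 1 := by
    rw [Real.exp_le_one_iff]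
    nlinarith [sq_nonneg t]
  exact mul_le_one₀ h1 (Real.exp_pos _).le h2

lemma integrable_stdPdf_mul {g : ℝ → ℝ} (hg : Continuous g) {C : ℝ} (hC : ∀ t, ‖g t‖ ≤ C) :
    Integrable fun s => stdPdf s * g s := by
  have := integrable_stdPdf.bdd_mul (f := g) (c := C) hg.aestronglyMeasurable
    (ae_of_all _ hC)
  simpa [mul_comm] using this

lemma norm_stdPhi_le_one (t : ℝ) : ‖stdPhi t‖ ≤ 1 := by
  rw [Real.norm_eq_abs, abs_of_nonneg (stdPhi_nonneg t)]
  exact stdPhi_le_one t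

lemma norm_stdPdf_le_one (t : ℝ) : ‖stdPdf t‖ ≤ 1 := by
  rw [Real.norm_eq_abs, abs_of_pos (stdPdf_pos t)]
  exact stdPdf_le_one t

section

variable {ρ c : ℝ}

lemma hasDerivAt_biPhi_left (a b : ℝ) :
    HasDerivAt (fun a => biPhi ρ c a b) (stdPdf a * stdPhi ((b + ρ * a) / c)) a := by
  have hcont : Continuous fun s => stdPhi ((b + ρ * s) / c) :=
    continuous_stdPhi.comp (by fun_prop)
  exact hasDerivAt_integral_Iic (integrable_stdPdf_mul hcont fun t => norm_stdPhi_le_one _)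
    (continuous_stdPdf.mul hcont) a

lemma integral_Iic_stdPdf_mul (hc : 0 < c) (h : ρ ^ 2 + c ^ 2 = 1) (a b : ℝ) :
    ∫ s in Iic a, stdPdf s * (stdPdf ((b + ρ * s) / c) / c)
      = stdPdf b * stdPhi ((a + ρ * b) / c) := by
  have hd : ∀ s ∈ Iic a, HasDerivAt (fun s => stdPdf b * stdPhi ((s + ρ * b) / c))
      (stdPdf s * (stdPdf ((b + ρ * s) / c) / c)) s := by
    intro s _
    have h1 : HasDerivAt (fun s => (s + ρ * b) / c) (1 / c) s :=
      ((hasDerivAt_id s).add_const _).div_const _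
    refine (((hasDerivAt_stdPhi _).comp s h1).const_mul (stdPdf b)).congr_deriv ?_
    linear_combination (-1 / c) * stdPdf_mul_stdPdf_comm hc h s b
  have hcont : Continuous fun s => stdPdf ((b + ρ * s) / c) / c :=
    (continuous_stdPdf.comp (by fun_prop)).div_const _
  have hi : Integrable fun s => stdPdf s * (stdPdf ((b + ρ * s) / c) / c) := by
    refine integrable_stdPdf_mul (C := 1 / c) hcont fun t => ?_
    rw [norm_div, Real.norm_of_nonneg hc.le]
    gcongr
    exact norm_stdPdf_le_one _
  have ht : Tendsto (fun s => stdPdf b * stdPhi ((s + ρ * b) / c)) atBot (𝓝 (stdPdf b * 0)) := by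
    refine (tendsto_stdPhi_atBot.comp ?_).const_mul _
    exact (tendsto_atBot_add_const_right _ _ tendsto_id).atBot_div_const hc
  rw [integral_Iic_of_hasDerivAt_of_tendsto' hd hi.integrableOn ht]
  ring

lemma hasDerivAt_biPhi_right (hc : 0 < c) (h : ρ ^ 2 + c ^ 2 = 1) (a b : ℝ) :
    HasDerivAt (fun b => biPhi ρ c a b) (stdPdf b * stdPhi ((a + ρ * b) / c)) b := by
  rw [← integral_Iic_stdPdf_mul hc h]
  refine (hasDerivAt_integral_of_dominated_loc_of_deriv_le (F := fun b s =>
    stdPdf s * stdPhi ((b + ρ * s) / c)) (F' := fun b s => stdPdf s * (stdPdf ((b + ρ * s) / c) / c))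
    (bound := fun s => stdPdf s * (1 / c)) univ_mem ?_ ?_ ?_ ?_ ?_ ?_).2
  · refine Eventually.of_forall fun b => Continuous.aestronglyMeasurable ?_
    exact continuous_stdPdf.mul (continuous_stdPhi.comp (by fun_prop))
  · exact (integrable_stdPdf_mul (continuous_stdPhi.comp (by fun_prop))
      fun t => norm_stdPhi_le_one _).integrableOn
  · refine Continuous.aestronglyMeasurable ?_
    exact continuous_stdPdf.mul ((continuous_stdPdf.comp (by fun_prop)).div_const _)
  · refine ae_of_all _ fun s x _ => ?_
    rw [norm_mul, norm_div, Real.norm_of_nonneg hc.le, Real.norm_of_nonneg (stdPdf_pos s).le]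
    have := norm_stdPdf_le_one ((x + ρ * s) / c)
    have := stdPdf_pos s
    gcongr
  · exact (integrable_stdPdf.mul_const _).integrableOn
  · refine ae_of_all _ fun s x _ => ?_
    have h1 : HasDerivAt (fun b => (b + ρ * s) / c) (1 / c) x :=
      ((hasDerivAt_id x).add_const _).div_const _
    refine (((hasDerivAt_stdPhi _).comp x h1).const_mul (stdPdf s)).congr_deriv ?_
    ring

lemma hasFDerivAt_biPhi (hc : 0 < c) (h : ρ ^ 2 + c ^ 2 = 1) (u : ℝ × ℝ) :
    HasFDerivAt (fun u : ℝ × ℝ => biPhi ρ c u.1 u.2)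
      ((ContinuousLinearMap.toSpanSingleton ℝ (stdPdf u.1 * stdPhi ((u.2 + ρ * u.1) / c))).coprod
        (ContinuousLinearMap.toSpanSingleton ℝ
          (stdPdf u.2 * stdPhi ((u.1 + ρ * u.2) / c)))) u := by
  have hcont1 : Continuous fun u : ℝ × ℝ => ContinuousLinearMap.toSpanSingleton ℝ
      (stdPdf u.1 * stdPhi ((u.2 + ρ * u.1) / c)) := by
    have : Continuous fun u : ℝ × ℝ => stdPdf u.1 * stdPhi ((u.2 + ρ * u.1) / c) :=
      (continuous_stdPdf.comp continuous_fst).mul (continuous_stdPhi.comp (by fun_prop))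
    exact (ContinuousLinearMap.toSpanSingletonCLE (𝕜 := ℝ)).continuous.comp this
  have hcont2 : Continuous fun u : ℝ × ℝ => ContinuousLinearMap.toSpanSingleton ℝ
      (stdPdf u.2 * stdPhi ((u.1 + ρ * u.2) / c)) := by
    have : Continuous fun u : ℝ × ℝ => stdPdf u.2 * stdPhi ((u.1 + ρ * u.2) / c) :=
      (continuous_stdPdf.comp continuous_snd).mul (continuous_stdPhi.comp (by fun_prop))
    exact (ContinuousLinearMap.toSpanSingletonCLE (𝕜 := ℝ)).continuous.comp this
  exact (hasStrictFDerivAt_uncurry_coprod (u := u) (f := biPhi ρ c)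
    (f₁ := fun a b => ContinuousLinearMap.toSpanSingleton ℝ (stdPdf a * stdPhi ((b + ρ * a) / c)))
    (f₂ := fun a b => ContinuousLinearMap.toSpanSingleton ℝ (stdPdf b * stdPhi ((a + ρ * b) / c)))
    (Eventually.of_forall fun v => (hasDerivAt_biPhi_left v.1 v.2).hasFDerivAt)
    (Eventually.of_forall fun v => (hasDerivAt_biPhi_right hc h v.1 v.2).hasFDerivAt)
    hcont1.continuousAt hcont2.continuousAt).hasFDerivAt

lemma biPhi_nonneg (a b : ℝ) : 0 ≤ biPhi ρ c a b :=
  integral_nonneg fun s => mul_nonneg (stdPdf_pos s).le (stdPhi_nonneg _)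

lemma biPhi_le_left (a b : ℝ) : biPhi ρ c a b ≤ stdPhi a := by
  rw [stdPhi_eq_integral]
  refine integral_mono (integrable_stdPdf_mul (continuous_stdPhi.comp (by fun_prop))
    fun t => norm_stdPhi_le_one _).integrableOn integrable_stdPdf.integrableOn fun s => ?_
  exact mul_le_of_le_one_right (stdPdf_pos s).le (stdPhi_le_one _)

lemma biPhi_mono_left (b : ℝ) : Monotone fun a => biPhi ρ c a b :=
  monotone_of_hasDerivAt_nonneg (fun a => hasDerivAt_biPhi_left a b)
    fun a => mul_nonneg (stdPdf_pos a).le (stdPhi_nonneg _)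

lemma biPhi_mono_right (hc : 0 < c) (h : ρ ^ 2 + c ^ 2 = 1) (a : ℝ) :
    Monotone fun b => biPhi ρ c a b :=
  monotone_of_hasDerivAt_nonneg (fun b => hasDerivAt_biPhi_right hc h a b)
    fun b => mul_nonneg (stdPdf_pos b).le (stdPhi_nonneg _)

lemma biPhi_le_right (hc : 0 < c) (a b : ℝ) (h : ρ ^ 2 + c ^ 2 = 1) : biPhi ρ c a b ≤ stdPhi b := by
  have hd : ∀ b, HasDerivAt (fun b => stdPhi b - biPhi ρ c a b)
      (stdPdf b * (1 - stdPhi ((a + ρ * b) / c))) b := fun b =>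
    ((hasDerivAt_stdPhi b).sub (hasDerivAt_biPhi_right hc h a b)).congr_deriv (by ring)
  have hm : Monotone fun b => stdPhi b - biPhi ρ c a b :=
    monotone_of_hasDerivAt_nonneg hd
      fun b => mul_nonneg (stdPdf_pos b).le (sub_nonneg.2 (stdPhi_le_one _))
  have ht : Tendsto (fun b => stdPhi b - biPhi ρ c a b) atBot (𝓝 (0 - 0)) := by
    refine tendsto_stdPhi_atBot.sub ?_
    have : (0 : ℝ) = ∫ s in Iic a, (0 : ℝ) := by simp
    rw [this]
    refine tendsto_integral_filter_of_dominated_convergence stdPdf ?_ ?_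
      integrable_stdPdf.integrableOn ?_
    · exact Eventually.of_forall fun b => (continuous_stdPdf.mul
        (continuous_stdPhi.comp (by fun_prop))).aestronglyMeasurable
    · refine Eventually.of_forall fun b => ae_of_all _ fun s => ?_
      rw [norm_mul, Real.norm_of_nonneg (stdPdf_pos s).le]
      exact mul_le_of_le_one_right (stdPdf_pos s).le (norm_stdPhi_le_one _)
    · refine ae_of_all _ fun s => ?_
      have : Tendsto (fun b => stdPhi ((b + ρ * s) / c)) atBot (𝓝 0) :=
        tendsto_stdPhi_atBot.comp
          ((tendsto_atBot_add_const_right _ _ tendsto_id).atBot_div_const hc)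
      simpa using this.const_mul (stdPdf s)
  have := hm.le_of_tendsto ht b
  simp only [sub_zero, sub_nonneg] at this
  exact this

end

lemma abs_taylor_two_le {g g' g'' : ℝ → ℝ} {K : ℝ}
    (h1 : ∀ t ∈ Icc (0 : ℝ) 1, HasDerivAt g (g' t) t)
    (h2 : ∀ t ∈ Icc (0 : ℝ) 1, HasDerivAt g' (g'' t) t)
    (hK : ∀ t ∈ Icc (0 : ℝ) 1, |g'' t - g'' 0| ≤ K) :
    |g 1 - g 0 - g' 0 - g'' 0 / 2| ≤ K := by
  have hK0 : 0 ≤ K := (abs_nonneg _).trans (hK 0 ⟨le_rfl, zero_le_one⟩)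
  have e1 : ∀ t ∈ Icc (0 : ℝ) 1, ‖(g' t - t * g'' 0) - (g' 0 - 0 * g'' 0)‖ ≤ K * (t - 0) := by
    refine norm_image_sub_le_of_norm_deriv_le_segment' (f' := fun t => g'' t - g'' 0) ?_
      fun t ht => hK t ⟨ht.1, ht.2.le⟩
    intro t ht
    exact (((h2 t ht).sub ((hasDerivAt_id t).mul_const (g'' 0))).congr_deriv
      (by simp)).hasDerivWithinAt
  have e2 := norm_image_sub_le_of_norm_deriv_le_segment_01' (C := K)
    (f := fun t => g t - t * g' 0 - t ^ 2 / 2 * g'' 0)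
    (f' := fun t => (g' t - t * g'' 0) - (g' 0 - 0 * g'' 0)) ?_ ?_
  · refine le_of_eq_of_le ?_ e2
    rw [Real.norm_eq_abs]
    congr 1
    ring
  · intro t ht
    have h3 : HasDerivAt (fun t : ℝ => t ^ 2 / 2) t t :=
      ((hasDerivAt_pow 2 t).div_const 2).congr_deriv (by norm_num)
    exact ((((h1 t ht).sub ((hasDerivAt_id t).mul_const (g' 0))).sub
      (h3.mul_const (g'' 0))).congr_deriv (by simp; ring)).hasDerivWithinAt
  · intro t ht
    refine (e1 t ⟨ht.1, ht.2.le⟩).trans ?_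
    have := ht.2.le
    nlinarith [ht.1]

/-- On `s × s`, the function `J` has second order Taylor expansions with a uniform cubic error and
with a Hessian of the form `2(ρα², αβ; αβ, ρβ²)`. -/
def TaylorBound (J : ℝ → ℝ → ℝ) (s : Set ℝ) (ρ C : ℝ) : Prop :=
  ∀ x ∈ s, ∀ y ∈ s, ∃ jx jy α β : ℝ, |jx| ≤ C ∧ |jy| ≤ C ∧ |α| ≤ C ∧ |β| ≤ C ∧
    ∀ U V : ℝ, x + U ∈ s → y + V ∈ s →
      |J (x + U) (y + V) - J x y - (jx * U + jy * V)
        - (ρ * (α * U) ^ 2 + 2 * (α * U) * (β * V) + ρ * (β * V) ^ 2)| ≤ C * (|U| + |V|) ^ 3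

/-- The function `J(x, y) = ℙ(Z₁ ≤ Φ⁻¹(x), Z₂ ≤ Φ⁻¹(y))`. -/
noncomputable def biCopula (ρ c x y : ℝ) : ℝ := biPhi ρ c (stdQuantile x) (stdQuantile y)

lemma exists_lipschitzOnWith_Icc {k : ℝ × ℝ → ℝ} (hk : ContDiff ℝ 1 k) (l u : ℝ) :
    ∃ K : ℝ, 0 ≤ K ∧ ∀ a ∈ Icc l u, ∀ b ∈ Icc l u, ∀ a' ∈ Icc l u, ∀ b' ∈ Icc l u,
      |k (a, b) - k (a', b')| ≤ K * (|a - a'| + |b - b'|) := by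
  obtain ⟨K, hK⟩ := (hk.locallyLipschitz.locallyLipschitzOn
    (s := Icc l u ×ˢ Icc l u)).exists_lipschitzOnWith_of_compact (isCompact_Icc.prod isCompact_Icc)
  refine ⟨K, K.2, fun a ha b hb a' ha' b' hb' => ?_⟩
  have := hK.dist_le_mul (a, b) ⟨ha, hb⟩ (a', b') ⟨ha', hb'⟩
  rw [Real.dist_eq] at this
  refine this.trans (mul_le_mul_of_nonneg_left ?_ K.2)
  rw [Prod.dist_eq, Real.dist_eq, Real.dist_eq]
  exact max_le_add_of_nonneg (abs_nonneg _) (abs_nonneg _)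

lemma exists_stdPdf_ge (l u : ℝ) : ∃ m > 0, ∀ a ∈ Icc l u, m ≤ stdPdf a := by
  rcases (Icc l u).eq_empty_or_nonempty with h | h
  · exact ⟨1, one_pos, by simp [h]⟩
  · obtain ⟨a, _, ha⟩ := isCompact_Icc.exists_isMinOn h continuous_stdPdf.continuousOn
    exact ⟨stdPdf a, stdPdf_pos a, fun b hb => ha hb⟩

lemma stdQuantile_mem_Icc {ε x : ℝ} (hε : 0 < ε) (hx : x ∈ Icc ε (1 - ε)) :
    stdQuantile x ∈ Icc (stdQuantile ε) (stdQuantile (1 - ε)) := by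
  have h1 : ε ∈ Ioo (0 : ℝ) 1 := ⟨hε, by linarith [hx.1, hx.2]⟩
  have h2 : 1 - ε ∈ Ioo (0 : ℝ) 1 := ⟨by linarith [hx.1, hx.2], by linarith⟩
  have h3 : x ∈ Ioo (0 : ℝ) 1 := ⟨by linarith [hx.1], by linarith [hx.2]⟩
  exact ⟨strictMonoOn_stdQuantile.monotoneOn h1 h3 hx.1,
    strictMonoOn_stdQuantile.monotoneOn h3 h2 hx.2⟩

lemma taylorBound_biCopula {ρ c ε : ℝ} (hρ : 0 < ρ) (hc : 0 < c) (h : ρ ^ 2 + c ^ 2 = 1)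
    (hε : 0 < ε) : ∃ C, 0 ≤ C ∧ TaylorBound (biCopula ρ c) (Icc ε (1 - ε)) ρ C := by
  set l := stdQuantile ε
  set u := stdQuantile (1 - ε)
  obtain ⟨m, hm, hml⟩ := exists_stdPdf_ge l u
  obtain ⟨K1, hK1, hk1⟩ := exists_lipschitzOnWith_Icc (l := l) (u := u)
    (k := fun u => stdPdf ((u.2 + ρ * u.1) / c) / stdPdf u.1)
    (((contDiff_stdPdf (k := 1)).comp (by fun_prop)).div ((contDiff_stdPdf (k := 1)).comp
      (by fun_prop)) fun u => (stdPdf_pos _).ne')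
  obtain ⟨K2, hK2, hk2⟩ := exists_lipschitzOnWith_Icc (l := l) (u := u)
    (k := fun u => stdPdf ((u.2 + ρ * u.1) / c) / stdPdf u.2)
    (((contDiff_stdPdf (k := 1)).comp (by fun_prop)).div ((contDiff_stdPdf (k := 1)).comp
      (by fun_prop)) fun u => (stdPdf_pos _).ne')
  obtain ⟨K3, hK3, hk3⟩ := exists_lipschitzOnWith_Icc (l := l) (u := u)
    (k := fun u => stdPdf ((u.1 + ρ * u.2) / c) / stdPdf u.2)
    (((contDiff_stdPdf (k := 1)).comp (by fun_prop)).div ((contDiff_stdPdf (k := 1)).comp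
      (by fun_prop)) fun u => (stdPdf_pos _).ne')
  set C0 := (ρ * K1 + 2 * K2 + ρ * K3) / (m * c) with hC0
  set r0 := Real.sqrt (1 / (2 * c)) with hr0
  have hr0sq : r0 ^ 2 = 1 / (2 * c) := Real.sq_sqrt (by positivity)
  refine ⟨max (max 1 (r0 / m)) C0, by positivity, fun x hx y hy => ?_⟩
  have hIoo : ∀ z ∈ Icc ε (1 - ε), z ∈ Ioo (0 : ℝ) 1 := fun z hz =>
    ⟨by linarith [hz.1], by linarith [hz.2]⟩
  set a := stdQuantile x with ha
  set b := stdQuantile y with hb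
  set T := stdPdf a * stdPdf ((b + ρ * a) / c) with hT
  have hTpos : 0 < T := mul_pos (stdPdf_pos _) (stdPdf_pos _)
  have hT1 : T ≤ 1 := mul_le_one₀ (stdPdf_le_one _) (stdPdf_pos _).le (stdPdf_le_one _)
  have hT' : T = stdPdf b * stdPdf ((a + ρ * b) / c) := stdPdf_mul_stdPdf_comm hc h a b
  set r := r0 * Real.sqrt T with hr
  have hrr : r ≤ r0 := mul_le_of_le_one_right (Real.sqrt_nonneg _) (Real.sqrt_le_one.2 hT1)
  have hr0' : 0 ≤ r := by positivity
  have hrsq : r ^ 2 = T / (2 * c) := by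
    rw [hr, mul_pow, hr0sq, Real.sq_sqrt hTpos.le]; ring
  have hma := hml a (stdQuantile_mem_Icc hε hx)
  have hmb := hml b (stdQuantile_mem_Icc hε hy)
  have hle : ∀ s, m ≤ s → |r / s| ≤ max (max 1 (r0 / m)) C0 := by
    intro s hs
    rw [abs_of_nonneg (div_nonneg hr0' (hm.le.trans hs))]
    refine le_trans ?_ ((le_max_right _ _).trans (le_max_left _ _))
    gcongr
  have hΦ : ∀ t, |stdPhi t| ≤ max (max 1 (r0 / m)) C0 := fun t =>
    (norm_stdPhi_le_one t).trans ((le_max_left _ _).trans (le_max_left _ _))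
  refine ⟨stdPhi ((b + ρ * a) / c), stdPhi ((a + ρ * b) / c), r / stdPdf a, r / stdPdf b,
    hΦ _, hΦ _, hle _ hma, hle _ hmb, fun U V hU hV => ?_⟩
  -- the curve joining the two points
  set A : ℝ → ℝ := fun t => stdQuantile (x + t * U) with hA
  set B : ℝ → ℝ := fun t => stdQuantile (y + t * V) with hB
  have hseg : ∀ z W : ℝ, z ∈ Icc ε (1 - ε) → z + W ∈ Icc ε (1 - ε) → ∀ t ∈ Icc (0 : ℝ) 1,
      z + t * W ∈ Icc ε (1 - ε) := by
    intro z W hz hW t ht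
    have := (convex_Icc ε (1 - ε)).add_smul_mem hz hW ht
    simpa using this
  have hdQ : ∀ z W : ℝ, z ∈ Icc ε (1 - ε) → z + W ∈ Icc ε (1 - ε) → ∀ t ∈ Icc (0 : ℝ) 1,
      HasDerivAt (fun t => stdQuantile (z + t * W)) (W / stdPdf (stdQuantile (z + t * W))) t := by
    intro z W hz hW t ht
    have h1 := hasDerivAt_stdQuantile (hIoo _ (hseg z W hz hW t ht))
    have h2 : HasDerivAt (fun t => z + t * W) W t := by
      simpa using ((hasDerivAt_id t).mul_const W).const_add z
    exact (h1.comp t h2).congr_deriv (by rw [div_eq_mul_inv]; ring)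
  have hLip : ∀ z W : ℝ, z ∈ Icc ε (1 - ε) → z + W ∈ Icc ε (1 - ε) → ∀ t ∈ Icc (0 : ℝ) 1,
      |stdQuantile (z + t * W) - stdQuantile z| ≤ |W| / m := by
    intro z W hz hW t ht
    have := norm_image_sub_le_of_norm_deriv_le_segment' (C := |W| / m)
      (fun t ht => (hdQ z W hz hW t ht).hasDerivWithinAt) (fun t ht => ?_) t ht
    · rw [Real.norm_eq_abs] at this
      simp only [zero_mul, add_zero, sub_zero] at this
      refine this.trans (mul_le_of_le_one_right (by positivity) ht.2)
    · have := hml _ (stdQuantile_mem_Icc hε (hseg z W hz hW t ⟨ht.1, ht.2.le⟩))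
      rw [norm_div, Real.norm_eq_abs, Real.norm_eq_abs, abs_of_pos (stdPdf_pos _)]
      gcongr
  set g : ℝ → ℝ := fun t => biPhi ρ c (A t) (B t) with hg
  set g' : ℝ → ℝ := fun t => U * stdPhi ((B t + ρ * A t) / c) + V * stdPhi ((A t + ρ * B t) / c)
    with hg'
  set g'' : ℝ → ℝ := fun t =>
    (ρ * (stdPdf ((B t + ρ * A t) / c) / stdPdf (A t)) * U ^ 2
      + 2 * (stdPdf ((B t + ρ * A t) / c) / stdPdf (B t)) * (U * V)
      + ρ * (stdPdf ((A t + ρ * B t) / c) / stdPdf (B t)) * V ^ 2) / c with hg''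
  have hA0 : A 0 = a := by simp [hA, ha]
  have hB0 : B 0 = b := by simp [hB, hb]
  have hmain := abs_taylor_two_le (g := g) (g' := g') (g'' := g'') (K := C0 * (|U| + |V|) ^ 3)
    ?_ ?_ ?_
  · refine le_trans (le_of_eq ?_) (hmain.trans (mul_le_mul_of_nonneg_right (le_max_right _ _)
      (by positivity)))
    congr 1
    have e1 : g 1 = biCopula ρ c (x + U) (y + V) := by simp [hg, hA, hB, biCopula]
    have e0 : g 0 = biCopula ρ c x y := by simp [hg, hA, hB, biCopula]
    rw [e1, e0]
    have e3 : g' 0 = stdPhi ((b + ρ * a) / c) * U + stdPhi ((a + ρ * b) / c) * V := by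
      simp only [hg', hA0, hB0]; ring
    have e4 : g'' 0 / 2 = ρ * (r / stdPdf a * U) ^ 2 + 2 * (r / stdPdf a * U) * (r / stdPdf b * V)
        + ρ * (r / stdPdf b * V) ^ 2 := by
      have q1 : stdPdf ((b + ρ * a) / c) = T / stdPdf a := by
        rw [hT]; field_simp [(stdPdf_pos a).ne']
      have q2 : stdPdf ((a + ρ * b) / c) = T / stdPdf b := by
        rw [hT']; field_simp [(stdPdf_pos b).ne']
      have q3 : T = r ^ 2 * (2 * c) := by rw [hrsq]; field_simp
      simp only [hg'', hA0, hB0, q1, q2]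
      rw [q3]
      have := (stdPdf_pos a).ne'
      have := (stdPdf_pos b).ne'
      field_simp
    rw [e3, e4]
  · intro t ht
    have h1 := hdQ x U hx hU t ht
    have h2 := hdQ y V hy hV t ht
    have := (hasFDerivAt_biPhi hc h (A t, B t)).comp_hasDerivAt t (h1.prodMk h2)
    refine this.congr_deriv ?_
    have := (stdPdf_pos (A t)).ne'
    have := (stdPdf_pos (B t)).ne'
    simp only [ContinuousLinearMap.coprod_apply, ContinuousLinearMap.toSpanSingleton_apply,
      smul_eq_mul, hg']
    change U / stdPdf (A t) * _ + V / stdPdf (B t) * _ = _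
    field_simp
  · intro t ht
    have h1 := hdQ x U hx hU t ht
    have h2 := hdQ y V hy hV t ht
    have p1 := (hasDerivAt_stdPhi ((B t + ρ * A t) / c)).comp t
      ((h2.add (h1.const_mul ρ)).div_const c)
    have p2 := (hasDerivAt_stdPhi ((A t + ρ * B t) / c)).comp t
      ((h1.add (h2.const_mul ρ)).div_const c)
    refine ((p1.const_mul U).add (p2.const_mul V)).congr_deriv ?_
    have hcomm := stdPdf_mul_stdPdf_comm hc h (A t) (B t)
    have e1 : stdPdf ((A t + ρ * B t) / c)
      = stdPdf (A t) * stdPdf ((B t + ρ * A t) / c) / stdPdf (B t) := by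
      rw [hcomm]; field_simp [(stdPdf_pos (B t)).ne']
    have := (stdPdf_pos (A t)).ne'
    have := (stdPdf_pos (B t)).ne'
    simp only [hg'', e1]
    change U * (_ * ((V / stdPdf (B t) + ρ * (U / stdPdf (A t))) / c))
      + V * (_ * ((U / stdPdf (A t) + ρ * (V / stdPdf (B t))) / c)) = _
    field_simp
    ring
  · intro t ht
    have ma := stdQuantile_mem_Icc hε (hseg x U hx hU t ht)
    have mb := stdQuantile_mem_Icc hε (hseg y V hy hV t ht)
    have ma0 := stdQuantile_mem_Icc hε hx
    have mb0 := stdQuantile_mem_Icc hε hy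
    have l1 := hLip x U hx hU t ht
    have l2 := hLip y V hy hV t ht
    have n1 := hk1 _ ma _ mb _ ma0 _ mb0
    have n2 := hk2 _ ma _ mb _ ma0 _ mb0
    have n3 := hk3 _ ma _ mb _ ma0 _ mb0
    simp only [hg'', hA0, hB0]
    simp only at n1 n2 n3
    change |stdPdf ((B t + ρ * A t) / c) / stdPdf (A t) - stdPdf ((b + ρ * a) / c) / stdPdf a|
      ≤ K1 * (|A t - a| + |B t - b|) at n1
    change |stdPdf ((B t + ρ * A t) / c) / stdPdf (B t) - stdPdf ((b + ρ * a) / c) / stdPdf b|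
      ≤ K2 * (|A t - a| + |B t - b|) at n2
    change |stdPdf ((A t + ρ * B t) / c) / stdPdf (B t) - stdPdf ((a + ρ * b) / c) / stdPdf b|
      ≤ K3 * (|A t - a| + |B t - b|) at n3
    change |A t - a| ≤ _ at l1
    change |B t - b| ≤ _ at l2
    generalize stdPdf ((B t + ρ * A t) / c) / stdPdf (A t) = X1 at *
    generalize stdPdf ((B t + ρ * A t) / c) / stdPdf (B t) = X2 at *
    generalize stdPdf ((A t + ρ * B t) / c) / stdPdf (B t) = X3 at *
    generalize stdPdf ((b + ρ * a) / c) / stdPdf a = Y1 at *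
    generalize stdPdf ((b + ρ * a) / c) / stdPdf b = Y2 at *
    generalize stdPdf ((a + ρ * b) / c) / stdPdf b = Y3 at *
    set d := |A t - a| + |B t - b| with hd
    have hd1 : d ≤ (|U| + |V|) / m := by rw [add_div]; exact add_le_add l1 l2
    have hd0 : 0 ≤ d := by positivity
    have e : (ρ * X1 * U ^ 2 + 2 * X2 * (U * V) + ρ * X3 * V ^ 2) / c
        - (ρ * Y1 * U ^ 2 + 2 * Y2 * (U * V) + ρ * Y3 * V ^ 2) / c
        = (ρ * (X1 - Y1) * U ^ 2 + 2 * (X2 - Y2) * (U * V) + ρ * (X3 - Y3) * V ^ 2) / c := by ring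
    rw [e, abs_div, abs_of_pos hc]
    set N := |U| + |V| with hN
    have hUN : |U| ≤ N := le_add_of_nonneg_right (abs_nonneg _)
    have hVN : |V| ≤ N := le_add_of_nonneg_left (abs_nonneg _)
    have hN0 : 0 ≤ N := by positivity
    have b1 : |ρ * (X1 - Y1) * U ^ 2| ≤ ρ * (K1 * d) * N ^ 2 := by
      rw [abs_mul, abs_mul, abs_of_pos hρ, abs_pow]; gcongr
    have b2 : |2 * (X2 - Y2) * (U * V)| ≤ 2 * (K2 * d) * (N * N) := by
      rw [abs_mul, abs_mul, abs_mul U, abs_two]; gcongr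
    have b3 : |ρ * (X3 - Y3) * V ^ 2| ≤ ρ * (K3 * d) * N ^ 2 := by
      rw [abs_mul, abs_mul, abs_of_pos hρ, abs_pow]; gcongr
    calc _ ≤ (ρ * (K1 * d) * N ^ 2 + 2 * (K2 * d) * (N * N) + ρ * (K3 * d) * N ^ 2) / c := by
          gcongr
          exact (abs_add_three _ _ _).trans (add_le_add_three b1 b2 b3)
      _ = (ρ * K1 + 2 * K2 + ρ * K3) / c * N ^ 2 * d := by ring
      _ ≤ (ρ * K1 + 2 * K2 + ρ * K3) / c * N ^ 2 * (N / m) := by gcongr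
      _ = C0 * N ^ 3 := by rw [hC0]; field_simp

section SmoothClass

variable {E : Type*} [NormedAddCommGroup E] [NormedSpace ℝ E]

/-- Continuous functions with values in `[ε, 1 - ε]` and with a first order expansion with uniform
quadratic error. -/
structure SmoothClass (ε L : ℝ) (f : E → ℝ) : Prop where
  mem : ∀ x, f x ∈ Icc ε (1 - ε)
  cont : Continuous f
  exists_deriv : ∃ D : E → (E →L[ℝ] ℝ), Continuous D ∧
    ∀ x, ‖D x‖ ≤ L ∧ ∀ v, |f (x + v) - f x - D x v| ≤ L * ‖v‖ ^ 2

/-- The average of `f` over a small displacement with law `γ`. -/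
noncomputable def smoothAvg [MeasurableSpace E] (γ : Measure E) (h : ℝ) (f : E → ℝ) (x : E) : ℝ :=
  ∫ u, f (x + h • u) ∂γ

lemma integrable_of_continuous_of_bounded {Ω F : Type*} [TopologicalSpace Ω] [MeasurableSpace Ω]
    [OpensMeasurableSpace Ω] [NormedAddCommGroup F] [SecondCountableTopology Ω]
    [TopologicalSpace.PseudoMetrizableSpace Ω]
    (μ : Measure Ω) [IsFiniteMeasure μ] {f : Ω → F} (hf : Continuous f) {C : ℝ}
    (hC : ∀ x, ‖f x‖ ≤ C) : Integrable f μ :=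
  Integrable.of_bound hf.aestronglyMeasurable C (ae_of_all _ hC)

lemma SmoothClass.norm_le {ε L : ℝ} (hε : 0 ≤ ε) {f : E → ℝ} (hf : SmoothClass ε L f) (x : E) :
    ‖f x‖ ≤ 1 := by
  have := hf.mem x
  rw [Real.norm_eq_abs, abs_le]
  exact ⟨by linarith [this.1], by linarith [this.2]⟩

variable [MeasurableSpace E] [BorelSpace E] [SecondCountableTopology E]

lemma SmoothClass.avg {γ : Measure E} [IsProbabilityMeasure γ] {ε L h : ℝ} (hε : 0 ≤ ε) {f : E → ℝ}
    (hf : SmoothClass ε L f) : SmoothClass ε L (smoothAvg γ h f) := by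
  have hInt : ∀ x, Integrable (fun u => f (x + h • u)) γ := fun x =>
    integrable_of_continuous_of_bounded γ (hf.cont.comp (by fun_prop)) fun u => hf.norm_le hε _
  obtain ⟨D, hD, hDL⟩ := hf.exists_deriv
  have hintD : ∀ x, Integrable (fun u => D (x + h • u)) γ := fun x =>
    integrable_of_continuous_of_bounded γ (hD.comp (by fun_prop)) fun u => (hDL _).1
  refine ⟨fun x => ⟨?_, ?_⟩, ?_, fun x => ∫ u, D (x + h • u) ∂γ, ?_, fun x => ⟨?_, fun v => ?_⟩⟩
  · have := integral_mono (integrable_const ε) (hInt x) fun u => (hf.mem _).1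
    simpa [smoothAvg] using this
  · have := integral_mono (hInt x) (integrable_const (1 - ε)) fun u => (hf.mem _).2
    simpa [smoothAvg] using this
  · exact continuous_of_dominated (fun x => (hInt x).1) (bound := fun _ => 1)
      (fun x => ae_of_all _ fun u => hf.norm_le hε _) (integrable_const _)
      (ae_of_all _ fun u => hf.cont.comp (by fun_prop))
  · exact continuous_of_dominated (fun x => (hintD x).1) (bound := fun _ => L)
      (fun x => ae_of_all _ fun u => (hDL _).1) (integrable_const _)
      (ae_of_all _ fun u => hD.comp (by fun_prop))
  · simpa using norm_integral_le_of_norm_le_const (μ := γ) (ae_of_all _ fun u => (hDL (x + h • u)).1)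
  · rw [ContinuousLinearMap.integral_apply (hintD x)]
    simp only [smoothAvg]
    have hsub : Integrable (fun u => f (x + v + h • u) - f (x + h • u)) γ :=
      (hInt _).sub (hInt _)
    rw [← integral_sub (hInt _) (hInt _), ← integral_sub hsub
      ((hintD x).apply_continuousLinearMap v)]
    have := norm_integral_le_of_norm_le_const (μ := γ) (C := L * ‖v‖ ^ 2)
      (f := fun u => f (x + v + h • u) - f (x + h • u) - D (x + h • u) v)
      (ae_of_all _ fun u => by
        have := (hDL (x + h • u)).2 v
        rw [add_right_comm] at this
        exact this)
    simpa using this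

end SmoothClass

lemma abs_mul_sub_le {U V l m h W : ℝ} (hh : 0 ≤ h) (hh1 : h ≤ 1) (hW : 0 ≤ W)
    (hU : |U - h * l| ≤ h ^ 2 * W) (hV : |V - h * m| ≤ h ^ 2 * W) (hl : |l| ≤ W) (hm : |m| ≤ W) :
    |U * V - h ^ 2 * (l * m)| ≤ 3 * (h ^ 3 * W ^ 2) := by
  have hV' : |V| ≤ 2 * (h * W) := by
    have : |V| ≤ |V - h * m| + |h * m| := by simpa using abs_add_le (V - h * m) (h * m)
    rw [abs_mul, abs_of_nonneg hh] at this
    have h2 : h * |m| ≤ h * W := by gcongr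
    have h3 : h ^ 2 * W ≤ h * W := by
      gcongr; nlinarith
    linarith
  have e : U * V - h ^ 2 * (l * m) = (U - h * l) * V + h * l * (V - h * m) := by ring
  rw [e]
  refine (abs_add_le _ _).trans ?_
  rw [abs_mul, abs_mul, abs_mul, abs_of_nonneg hh]
  calc _ ≤ h ^ 2 * W * (2 * (h * W)) + h * W * (h ^ 2 * W) := by gcongr
    _ = _ := by ring

lemma quadratic_form_ge {ρ C α β U V l m h W : ℝ} (hρ : 0 ≤ ρ) (hρ1 : ρ ≤ 1) (hh : 0 ≤ h)
    (hh1 : h ≤ 1) (hW : 0 ≤ W) (hα : |α| ≤ C) (hβ : |β| ≤ C)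
    (hU : |U - h * l| ≤ h ^ 2 * W) (hV : |V - h * m| ≤ h ^ 2 * W) (hl : |l| ≤ W) (hm : |m| ≤ W) :
    h ^ 2 * (ρ * (α * l) ^ 2 + 2 * (α * l) * (β * m) + ρ * (β * m) ^ 2)
      - 12 * C ^ 2 * (h ^ 3 * W ^ 2) ≤
    ρ * (α * U) ^ 2 + 2 * (α * U) * (β * V) + ρ * (β * V) ^ 2 := by
  have h1 := abs_mul_sub_le hh hh1 hW hU hU hl hl
  have h2 := abs_mul_sub_le hh hh1 hW hU hV hl hm
  have h3 := abs_mul_sub_le hh hh1 hW hV hV hm hm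
  have hC : 0 ≤ C := (abs_nonneg _).trans hα
  set R := 3 * (h ^ 3 * W ^ 2) with hR
  have hR0 : 0 ≤ R := by positivity
  have b1 : |ρ * α ^ 2 * (U * U - h ^ 2 * (l * l))| ≤ 1 * C ^ 2 * R := by
    rw [abs_mul, abs_mul, abs_of_nonneg hρ, abs_pow]; gcongr
  have b2 : |2 * (α * β) * (U * V - h ^ 2 * (l * m))| ≤ 2 * (C * C) * R := by
    rw [abs_mul, abs_mul, abs_mul α, abs_two]; gcongr
  have b3 : |ρ * β ^ 2 * (V * V - h ^ 2 * (m * m))| ≤ 1 * C ^ 2 * R := by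
    rw [abs_mul, abs_mul, abs_of_nonneg hρ, abs_pow]; gcongr
  have := neg_abs_le (ρ * α ^ 2 * (U * U - h ^ 2 * (l * l)))
  have := neg_abs_le (2 * (α * β) * (U * V - h ^ 2 * (l * m)))
  have := neg_abs_le (ρ * β ^ 2 * (V * V - h ^ 2 * (m * m)))
  nlinarith

lemma abs_le_two_mul {U l h W : ℝ} (hh : 0 ≤ h) (hh1 : h ≤ 1) (hW : 0 ≤ W)
    (hU : |U - h * l| ≤ h ^ 2 * W) (hl : |l| ≤ W) : |U| ≤ 2 * (h * W) := by
  have : |U| ≤ |U - h * l| + |h * l| := by simpa using abs_add_le (U - h * l) (h * l)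
  rw [abs_mul, abs_of_nonneg hh] at this
  have h2 : h * |l| ≤ h * W := by gcongr
  have h3 : h ^ 2 * W ≤ h * W := by gcongr; nlinarith
  linarith

lemma quadratic_form_le {ρ C α β U V R : ℝ} (hρ1 : ρ ≤ 1) (hα : |α| ≤ C) (hβ : |β| ≤ C)
    (hU : |U| ≤ R) (hV : |V| ≤ R) :
    ρ * (α * U) ^ 2 + 2 * (α * U) * (β * V) + ρ * (β * V) ^ 2 ≤ 4 * C ^ 2 * R ^ 2 := by
  have hC : 0 ≤ C := (abs_nonneg _).trans hα
  have hR : 0 ≤ R := (abs_nonneg _).trans hU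
  have h1 : |α * U| ≤ C * R := by rw [abs_mul]; gcongr
  have h2 : |β * V| ≤ C * R := by rw [abs_mul]; gcongr
  have e1 : (α * U) ^ 2 ≤ (C * R) ^ 2 := sq_le_sq' (abs_le.1 h1).1 (abs_le.1 h1).2
  have e2 : (β * V) ^ 2 ≤ (C * R) ^ 2 := sq_le_sq' (abs_le.1 h2).1 (abs_le.1 h2).2
  have e3 : (α * U) * (β * V) ≤ (C * R) * (C * R) := by
    refine (le_abs_self _).trans ?_
    rw [abs_mul]; gcongr
  have e4 : ρ * (α * U) ^ 2 ≤ 1 * (α * U) ^ 2 := by gcongr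
  have e5 : ρ * (β * V) ^ 2 ≤ 1 * (β * V) ^ 2 := by gcongr
  nlinarith

lemma ge_of_taylorBound {J : ℝ → ℝ → ℝ} {ρ C x y jx jy α β U V l m h W : ℝ}
    (hρ : 0 ≤ ρ) (hρ1 : ρ ≤ 1) (hC : 0 ≤ C) (hh : 0 ≤ h) (hh1 : h ≤ 1) (hW : 1 ≤ W)
    (hα : |α| ≤ C) (hβ : |β| ≤ C)
    (hT : |J (x + U) (y + V) - J x y - (jx * U + jy * V)
        - (ρ * (α * U) ^ 2 + 2 * (α * U) * (β * V) + ρ * (β * V) ^ 2)| ≤ C * (|U| + |V|) ^ 3)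
    (hU : |U - h * l| ≤ h ^ 2 * W) (hV : |V - h * m| ≤ h ^ 2 * W) (hl : |l| ≤ W) (hm : |m| ≤ W) :
    J x y + (jx * U + jy * V) + h ^ 2 * (ρ * (α * l) ^ 2 + 2 * (α * l) * (β * m) + ρ * (β * m) ^ 2)
      - (12 * C ^ 2 + 64 * C) * h ^ 3 * W ^ 3 ≤ J (x + U) (y + V) := by
  have hW0 : 0 ≤ W := by linarith
  have h1 := quadratic_form_ge hρ hρ1 hh hh1 hW0 hα hβ hU hV hl hm
  have h2 : C * (|U| + |V|) ^ 3 ≤ 64 * C * h ^ 3 * W ^ 3 := by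
    have := abs_le_two_mul hh hh1 hW0 hU hl
    have := abs_le_two_mul hh hh1 hW0 hV hm
    calc C * (|U| + |V|) ^ 3 ≤ C * (2 * (h * W) + 2 * (h * W)) ^ 3 := by gcongr
      _ = _ := by ring
  have h3 : 12 * C ^ 2 * (h ^ 3 * W ^ 2) ≤ 12 * C ^ 2 * (h ^ 3 * W ^ 3) := by
    gcongr ?_ * (_ * ?_)
    exact pow_le_pow_right₀ hW (by norm_num)
  have := (abs_le.1 hT).1
  linarith

lemma exists_weight {E H : Type*} [NormedAddCommGroup E] [NormedSpace ℝ E]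
    [NormedAddCommGroup H] [NormedSpace ℝ H] (X Y : H →L[ℝ] E) {L : ℝ} (hL : 0 ≤ L) : ∃ B : ℝ, 1 ≤ B ∧
    ∀ v : H, L * ‖X v‖ ≤ B * (1 + ‖v‖ ^ 2) ∧ L * ‖Y v‖ ≤ B * (1 + ‖v‖ ^ 2) ∧
      L * ‖X v‖ ^ 2 ≤ B * (1 + ‖v‖ ^ 2) ∧ L * ‖Y v‖ ^ 2 ≤ B * (1 + ‖v‖ ^ 2) := by
  have key : ∀ (Z : H →L[ℝ] E) (N : ℝ), ‖Z‖ ≤ N → ∀ v, L * ‖Z v‖ ≤ (1 + L * (1 + N) ^ 2) * (1 + ‖v‖ ^ 2)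
      ∧ L * ‖Z v‖ ^ 2 ≤ (1 + L * (1 + N) ^ 2) * (1 + ‖v‖ ^ 2) := by
    intro Z N hN v
    have hN0 : 0 ≤ N := (norm_nonneg _).trans hN
    have h1 : ‖Z v‖ ≤ N * ‖v‖ := (Z.le_opNorm v).trans (by gcongr)
    have h2 : ‖v‖ ≤ 1 + ‖v‖ ^ 2 := by nlinarith [sq_nonneg (‖v‖ - 1)]
    constructor
    · calc L * ‖Z v‖ ≤ L * (N * ‖v‖) := by gcongr
        _ ≤ L * ((1 + N) ^ 2 * (1 + ‖v‖ ^ 2)) := by gcongr; nlinarith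
        _ ≤ _ := by nlinarith [sq_nonneg ‖v‖]
    · calc L * ‖Z v‖ ^ 2 ≤ L * (N * ‖v‖) ^ 2 := by gcongr
        _ = L * (N ^ 2 * ‖v‖ ^ 2) := by ring
        _ ≤ L * ((1 + N) ^ 2 * (1 + ‖v‖ ^ 2)) := by gcongr <;> linarith
        _ ≤ _ := by nlinarith [sq_nonneg ‖v‖]
  refine ⟨1 + L * (1 + (‖X‖ + ‖Y‖)) ^ 2, by nlinarith [sq_nonneg (1 + (‖X‖ + ‖Y‖))], fun v => ?_⟩
  have hX := key X (‖X‖ + ‖Y‖) (by linarith [norm_nonneg Y]) v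
  have hY := key Y (‖X‖ + ‖Y‖) (by linarith [norm_nonneg X]) v
  exact ⟨hX.1, hY.1, hX.2, hY.2⟩

lemma smoothAvg_eq {E H : Type*} [NormedAddCommGroup E] [NormedSpace ℝ E] [MeasurableSpace E]
    [BorelSpace E] [NormedAddCommGroup H] [NormedSpace ℝ H] [MeasurableSpace H] [BorelSpace H]
    [SecondCountableTopologyEither E ℝ] {γ : Measure E} {μ : Measure H} {X : H →L[ℝ] E} {h : ℝ} {f : E → ℝ} (hf : Continuous f) (hX : μ.map X = γ) (x : E) :
    smoothAvg γ h f x = ∫ v, f (x + h • X v) ∂μ := by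
  rw [smoothAvg, ← hX, integral_map X.continuous.aemeasurable]
  exact (hf.comp (by fun_prop)).aestronglyMeasurable

section Correlated

variable {E H : Type*} [NormedAddCommGroup E] [NormedSpace ℝ E] [MeasurableSpace E] [BorelSpace E]
  [SecondCountableTopology E] [NormedAddCommGroup H] [NormedSpace ℝ H] [MeasurableSpace H]
  [BorelSpace H] [SecondCountableTopology H]

/-- A pair of linear images `X`, `Y` with common law `γ` of a centered law `μ` with all moments,
with correlation at least `-ρ` in the sense of quadratic forms. -/
structure CorrelatedPair (γ : Measure E) (μ : Measure H) (X Y : H →L[ℝ] E) (ρ : ℝ) : Prop where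
  map_left : μ.map X = γ
  map_right : μ.map Y = γ
  integrable_pow : ∀ k : ℕ, Integrable (fun v => ‖v‖ ^ k) μ
  integral_apply : ∀ p : H →L[ℝ] ℝ, ∫ v, p v ∂μ = 0
  quad_nonneg : ∀ p r : E →L[ℝ] ℝ,
    0 ≤ ∫ v, (ρ * (p (X v)) ^ 2 + 2 * p (X v) * r (Y v) + ρ * (r (Y v)) ^ 2) ∂μ

variable {γ : Measure E} {μ : Measure H} [IsProbabilityMeasure γ] [IsProbabilityMeasure μ]
  {X Y : H →L[ℝ] E} {ρ : ℝ}

lemma CorrelatedPair.step (hP : CorrelatedPair γ μ X Y ρ) {J : ℝ → ℝ → ℝ} {ε C L : ℝ}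
    (hρ : 0 ≤ ρ) (hρ1 : ρ ≤ 1) (hC : 0 ≤ C) (hL : 0 ≤ L) (hε : 0 ≤ ε)
    (hT : TaylorBound J (Icc ε (1 - ε)) ρ C)
    (hJc : ContinuousOn (fun u : ℝ × ℝ => J u.1 u.2) (Icc ε (1 - ε) ×ˢ Icc ε (1 - ε)))
    (hJ1 : ∀ x y, |J x y| ≤ 1) :
    ∃ K : ℝ, ∀ f g : E → ℝ, SmoothClass ε L f → SmoothClass ε L g → ∀ h, 0 ≤ h → h ≤ 1 →
      ∀ x y, J (smoothAvg γ h f x) (smoothAvg γ h g y) - K * h ^ 3 ≤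
        ∫ v, J (f (x + h • X v)) (g (y + h • Y v)) ∂μ := by
  obtain ⟨B, hB, hBv⟩ := exists_weight X Y hL
  set W : H → ℝ := fun v => B * (1 + ‖v‖ ^ 2) with hW
  have hW1 : ∀ v, 1 ≤ W v := fun v => by simp only [hW]; nlinarith [sq_nonneg ‖v‖]
  have hW3 : Integrable (fun v => W v ^ 3) μ := by
    have : (fun v => W v ^ 3) = fun v : H => B ^ 3 * (‖v‖ ^ 0 + 3 * ‖v‖ ^ 2 + 3 * ‖v‖ ^ 4
        + ‖v‖ ^ 6) := by
      ext v; simp only [hW]; ring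
    rw [this]
    exact ((((hP.integrable_pow 0).add ((hP.integrable_pow 2).const_mul 3)).add
      ((hP.integrable_pow 4).const_mul 3)).add (hP.integrable_pow 6)).const_mul _
  have hWcont : Continuous W := by fun_prop
  have hW13 : ∀ v, W v ≤ W v ^ 3 := fun v => le_self_pow₀ (hW1 v) (by norm_num)
  have hW23 : ∀ v, W v ^ 2 ≤ W v ^ 3 := fun v => pow_le_pow_right₀ (hW1 v) (by norm_num)
  set M := ∫ v, W v ^ 3 ∂μ with hM
  have hM0 : 0 ≤ M := integral_nonneg fun v => by have := hW1 v; positivity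
  refine ⟨(12 * C ^ 2 + 64 * C) * M + 4 * C ^ 2 * M ^ 2 + 8 * C * M ^ 3,
    fun f g hf hg h hh hh1 x y => ?_⟩
  obtain ⟨jx, jy, α, β, hjx, hjy, hα, hβ, hTxy⟩ := hT _ (hf.mem x) _ (hg.mem y)
  obtain ⟨D, _, hD⟩ := hf.exists_deriv
  obtain ⟨D', _, hD'⟩ := hg.exists_deriv
  set l : H → ℝ := fun v => D x (X v) with hl
  set m : H → ℝ := fun v => D' y (Y v) with hm
  set U : H → ℝ := fun v => f (x + h • X v) - f x with hU
  set V : H → ℝ := fun v => g (y + h • Y v) - g y with hV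
  have hlW : ∀ v, |l v| ≤ W v := fun v =>
    ((D x).le_of_opNorm_le (hD x).1 (X v)).trans (hBv v).1
  have hmW : ∀ v, |m v| ≤ W v := fun v =>
    ((D' y).le_of_opNorm_le (hD' y).1 (Y v)).trans (hBv v).2.1
  have hUW : ∀ v, |U v - h * l v| ≤ h ^ 2 * W v := fun v => by
    have := (hD x).2 (h • X v)
    rw [map_smul, smul_eq_mul, norm_smul, Real.norm_of_nonneg hh] at this
    refine this.trans ?_
    calc _ = h ^ 2 * (L * ‖X v‖ ^ 2) := by ring
      _ ≤ _ := by gcongr; exact (hBv v).2.2.1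
  have hVW : ∀ v, |V v - h * m v| ≤ h ^ 2 * W v := fun v => by
    have := (hD' y).2 (h • Y v)
    rw [map_smul, smul_eq_mul, norm_smul, Real.norm_of_nonneg hh] at this
    refine this.trans ?_
    calc _ = h ^ 2 * (L * ‖Y v‖ ^ 2) := by ring
      _ ≤ _ := by gcongr; exact (hBv v).2.2.2
  have hfi : Integrable (fun v => f (x + h • X v)) μ :=
    integrable_of_continuous_of_bounded μ (hf.cont.comp (by fun_prop)) fun u => hf.norm_le hε _
  have hgi : Integrable (fun v => g (y + h • Y v)) μ :=
    integrable_of_continuous_of_bounded μ (hg.cont.comp (by fun_prop)) fun u => hg.norm_le hε _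
  have hUi : Integrable U μ := hfi.sub (integrable_const _)
  have hVi : Integrable V μ := hgi.sub (integrable_const _)
  have hlc : Continuous l := by fun_prop
  have hmc : Continuous m := by fun_prop
  have hli : Integrable l μ := hW3.mono' hlc.aestronglyMeasurable
    (ae_of_all _ fun v => (hlW v).trans (hW13 v))
  have hmi : Integrable m μ := hW3.mono' hmc.aestronglyMeasurable
    (ae_of_all _ fun v => (hmW v).trans (hW13 v))
  have hWi : Integrable W μ := hW3.mono' hWcont.aestronglyMeasurable
    (ae_of_all _ fun v => by
      rw [Real.norm_of_nonneg (by linarith [hW1 v])]; exact hW13 v)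
  have hl0 : ∫ v, l v ∂μ = 0 := hP.integral_apply ((D x).comp X)
  have hm0 : ∫ v, m v ∂μ = 0 := hP.integral_apply ((D' y).comp Y)
  set Q : H → ℝ := fun v => ρ * (α * l v) ^ 2 + 2 * (α * l v) * (β * m v) + ρ * (β * m v) ^ 2 with hQ
  have hQ0 : 0 ≤ ∫ v, Q v ∂μ := hP.quad_nonneg (α • D x) (β • D' y)
  have hprod : ∀ a b : H → ℝ, Continuous a → Continuous b → (∀ v, |a v| ≤ W v) →
      (∀ v, |b v| ≤ W v) → Integrable (fun v => a v * b v) μ := by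
    intro a b ha hb haW hbW
    refine hW3.mono' (ha.mul hb).aestronglyMeasurable (ae_of_all _ fun v => ?_)
    refine le_trans ?_ (hW23 v)
    rw [Real.norm_eq_abs, abs_mul, sq]
    exact mul_le_mul (haW v) (hbW v) (abs_nonneg _) (by linarith [hW1 v])
  have hQi : Integrable Q μ := by
    have e : Q = fun v => ρ * α ^ 2 * (l v * l v) + 2 * (α * β) * (l v * m v)
        + ρ * β ^ 2 * (m v * m v) := by ext v; simp only [hQ]; ring
    rw [e]
    exact (((hprod l l hlc hlc hlW hlW).const_mul _).add
      ((hprod l m hlc hmc hlW hmW).const_mul _)).add ((hprod m m hmc hmc hmW hmW).const_mul _)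
  have hUbar : smoothAvg γ h f x = f x + ∫ v, U v ∂μ := by
    rw [smoothAvg_eq hf.cont hP.map_left, hU, integral_sub hfi (integrable_const _)]
    simp
  have hVbar : smoothAvg γ h g y = g y + ∫ v, V v ∂μ := by
    rw [smoothAvg_eq hg.cont hP.map_right, hV, integral_sub hgi (integrable_const _)]
    simp
  have hbar : ∀ a b : H → ℝ, Integrable a μ → Integrable b μ → ∫ v, b v ∂μ = 0 →
      (∀ v, |a v - h * b v| ≤ h ^ 2 * W v) → |∫ v, a v ∂μ| ≤ h ^ 2 * M := by
    intro a b ha hb hb0 hab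
    have e : ∫ v, a v ∂μ = ∫ v, (a v - h * b v) ∂μ := by
      rw [integral_sub ha (hb.const_mul h), integral_const_mul, hb0]; ring
    rw [e]
    have h1 := norm_integral_le_of_norm_le (f := fun v => a v - h * b v)
      (hWi.const_mul (h ^ 2)) (ae_of_all _ hab)
    refine h1.trans ?_
    rw [integral_const_mul]
    gcongr
    exact integral_mono hWi hW3 hW13
  have hUb := hbar U l hUi hli hl0 hUW
  have hVb := hbar V m hVi hmi hm0 hVW
  -- upper bound at the averages
  have hup : J (smoothAvg γ h f x) (smoothAvg γ h g y) ≤ J (f x) (g y)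
      + (jx * ∫ v, U v ∂μ) + (jy * ∫ v, V v ∂μ) + 4 * C ^ 2 * M ^ 2 * h ^ 3 + 8 * C * M ^ 3 * h ^ 3 := by
    have hmf : f x + ∫ v, U v ∂μ ∈ Icc ε (1 - ε) := hUbar ▸ (hf.avg (h := h) hε).mem x
    have hmg : g y + ∫ v, V v ∂μ ∈ Icc ε (1 - ε) := hVbar ▸ (hg.avg (h := h) hε).mem y
    have h1 := (abs_le.1 (hTxy _ _ hmf hmg)).2
    rw [hUbar, hVbar]
    have h2 := quadratic_form_le hρ1 hα hβ hUb hVb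
    have h3 : C * (|∫ v, U v ∂μ| + |∫ v, V v ∂μ|) ^ 3 ≤ 8 * C * M ^ 3 * h ^ 3 := by
      calc _ ≤ C * (h ^ 2 * M + h ^ 2 * M) ^ 3 := by gcongr
        _ = 8 * C * M ^ 3 * h ^ 6 := by ring
        _ ≤ _ := by
          gcongr ?_ * ?_
          exact pow_le_pow_of_le_one hh hh1 (by norm_num)
    have h4 : 4 * C ^ 2 * (h ^ 2 * M) ^ 2 ≤ 4 * C ^ 2 * M ^ 2 * h ^ 3 := by
      calc _ = 4 * C ^ 2 * M ^ 2 * h ^ 4 := by ring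
        _ ≤ _ := by
          gcongr ?_ * ?_
          exact pow_le_pow_of_le_one hh hh1 (by norm_num)
    linarith
  -- integrated lower bound
  have hJi : Integrable (fun v => J (f (x + h • X v)) (g (y + h • Y v))) μ := by
    refine integrable_of_continuous_of_bounded μ (C := 1) ?_ fun v => hJ1 _ _
    exact hJc.comp_continuous (f := fun v => (f (x + h • X v), g (y + h • Y v)))
      ((hf.cont.comp (by fun_prop)).prodMk (hg.cont.comp (by fun_prop)))
      fun v => ⟨hf.mem _, hg.mem _⟩
  have hlow := integral_mono (μ := μ) (f := fun v => J (f x) (g y) + (jx * U v + jy * V v) + h ^ 2 * Q v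
    - (12 * C ^ 2 + 64 * C) * h ^ 3 * W v ^ 3) (g := fun v => J (f (x + h • X v)) (g (y + h • Y v)))
    ((((integrable_const _).add ((hUi.const_mul _).add (hVi.const_mul _))).add
      (hQi.const_mul _)).sub (hW3.const_mul _)) hJi (fun v => ?_)
  · have e : ∫ v, (J (f x) (g y) + (jx * U v + jy * V v) + h ^ 2 * Q v
        - (12 * C ^ 2 + 64 * C) * h ^ 3 * W v ^ 3) ∂μ = J (f x) (g y)
        + (jx * (∫ v, U v ∂μ) + jy * ∫ v, V v ∂μ) + h ^ 2 * (∫ v, Q v ∂μ)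
        - (12 * C ^ 2 + 64 * C) * h ^ 3 * M := by
      have i1 : Integrable (fun v => jx * U v + jy * V v) μ := (hUi.const_mul _).add (hVi.const_mul _)
      have i2 : Integrable (fun v => J (f x) (g y) + (jx * U v + jy * V v)) μ :=
        (integrable_const _).add i1
      have i3 : Integrable (fun v => J (f x) (g y) + (jx * U v + jy * V v) + h ^ 2 * Q v) μ :=
        i2.add (hQi.const_mul _)
      rw [integral_sub i3 (hW3.const_mul _), integral_add i2 (hQi.const_mul _),
        integral_add (integrable_const _) i1, integral_add (hUi.const_mul _) (hVi.const_mul _)]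
      simp only [integral_const_mul]
      simp [hM]
    rw [e] at hlow
    have : 0 ≤ h ^ 2 * ∫ v, Q v ∂μ := by positivity
    refine le_trans ?_ hlow
    linarith
  · have hm1 : f x + U v ∈ Icc ε (1 - ε) := by simpa [hU] using hf.mem (x + h • X v)
    have hm2 : g y + V v ∈ Icc ε (1 - ε) := by simpa [hV] using hg.mem (y + h • Y v)
    have := ge_of_taylorBound hρ hρ1 hC hh hh1 (hW1 v) hα hβ (hTxy _ _ hm1 hm2)
      (hUW v) (hVW v) (hlW v) (hmW v)
    simpa [hU, hV] using this


/-- The law `μ` is stable of index two. -/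
def IsStableTwo {F : Type*} [AddCommGroup F] [Module ℝ F] [MeasurableSpace F]
    (μ : Measure F) : Prop :=
  ∀ s t : ℝ, 0 ≤ s → 0 ≤ t → (μ.prod μ).map (fun z => s • z.1 + t • z.2)
    = μ.map fun v => Real.sqrt (s ^ 2 + t ^ 2) • v

lemma IsStableTwo.integral_integral {F : Type*} [NormedAddCommGroup F] [NormedSpace ℝ F]
    [MeasurableSpace F] [BorelSpace F] [SecondCountableTopology F] {μ : Measure F}
    [IsProbabilityMeasure μ] (hμ : IsStableTwo μ) {s t : ℝ} (hs : 0 ≤ s) (ht : 0 ≤ t) {G : F → ℝ}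
    (hG : Continuous G) {C : ℝ} (hC : ∀ v, ‖G v‖ ≤ C) :
    ∫ v, ∫ w, G (s • v + t • w) ∂μ ∂μ = ∫ v, G (Real.sqrt (s ^ 2 + t ^ 2) • v) ∂μ := by
  rw [← integral_prod (f := fun z : F × F => G (s • z.1 + t • z.2))
    (integrable_of_continuous_of_bounded _ (hG.comp (by fun_prop)) fun _ => hC _),
    ← integral_map (φ := fun v => Real.sqrt (s ^ 2 + t ^ 2) • v) (by fun_prop)
      hG.aestronglyMeasurable, ← hμ s t hs ht,
    integral_map (by fun_prop) hG.aestronglyMeasurable]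

lemma IsStableTwo.smoothAvg_smoothAvg (hγ : IsStableTwo γ) {s t ε L : ℝ} (hs : 0 ≤ s) (ht : 0 ≤ t)
    (hε : 0 ≤ ε) {f : E → ℝ} (hf : SmoothClass ε L f) (x : E) :
    smoothAvg γ s (smoothAvg γ t f) x = smoothAvg γ (Real.sqrt (s ^ 2 + t ^ 2)) f x := by
  have := hγ.integral_integral hs ht (G := fun v => f (x + v)) (hf.cont.comp (by fun_prop))
    fun v => hf.norm_le hε _
  simpa [smoothAvg, add_assoc] using this

lemma CorrelatedPair.iterate (hγ : IsStableTwo γ) (hμ : IsStableTwo μ)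
    {J : ℝ → ℝ → ℝ} {ε L K h : ℝ} (hε : 0 ≤ ε) (hh : 0 ≤ h)
    (hJc : ContinuousOn (fun u : ℝ × ℝ => J u.1 u.2) (Icc ε (1 - ε) ×ˢ Icc ε (1 - ε)))
    (hJ1 : ∀ x y, |J x y| ≤ 1)
    (hstep : ∀ f g : E → ℝ, SmoothClass ε L f → SmoothClass ε L g →
      ∀ x y, J (smoothAvg γ h f x) (smoothAvg γ h g y) - K ≤
        ∫ v, J (f (x + h • X v)) (g (y + h • Y v)) ∂μ) (k : ℕ) :
    ∀ f g : E → ℝ, SmoothClass ε L f → SmoothClass ε L g → ∀ x y,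
      J (smoothAvg γ (Real.sqrt k * h) f x) (smoothAvg γ (Real.sqrt k * h) g y) - k * K ≤
        ∫ v, J (f (x + (Real.sqrt k * h) • X v)) (g (y + (Real.sqrt k * h) • Y v)) ∂μ := by
  have hcont : ∀ f g : E → ℝ, SmoothClass ε L f → SmoothClass ε L g → ∀ x y,
      Continuous fun v => J (f (x + X v)) (g (y + Y v)) := fun f g hf hg x y =>
    hJc.comp_continuous (f := fun v => (f (x + X v), g (y + Y v)))
      ((hf.cont.comp (by fun_prop)).prodMk (hg.cont.comp (by fun_prop)))
      fun v => ⟨hf.mem _, hg.mem _⟩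
  induction k with
  | zero => intro f g hf hg x y; simp [smoothAvg]
  | succ k ih =>
    intro f g hf hg x y
    set s := Real.sqrt k * h with hs
    have hs0 : 0 ≤ s := by positivity
    have hsk : Real.sqrt (s ^ 2 + h ^ 2) = Real.sqrt ((k + 1 : ℕ) : ℝ) * h := by
      rw [hs, mul_pow, Real.sq_sqrt (Nat.cast_nonneg k)]
      have : (k : ℝ) * h ^ 2 + h ^ 2 = ((k + 1 : ℕ) : ℝ) * h ^ 2 := by push_cast; ring
      rw [this, Real.sqrt_mul (Nat.cast_nonneg _), Real.sqrt_sq hh]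
    have h1 := ih _ _ (hf.avg (γ := γ) (h := h) hε) (hg.avg (γ := γ) (h := h) hε) x y
    rw [hγ.smoothAvg_smoothAvg hs0 hh hε hf, hγ.smoothAvg_smoothAvg hs0 hh hε hg, hsk] at h1
    have h2 := hμ.integral_integral hs0 hh (hcont f g hf hg x y) (C := 1) fun v => hJ1 _ _
    rw [hsk] at h2
    simp only [map_add, map_smul, ← add_assoc] at h2
    rw [← h2]
    have hGc : Continuous fun z : H × H =>
        J (f (x + s • X z.1 + h • X z.2)) (g (y + s • Y z.1 + h • Y z.2)) :=
      hJc.comp_continuous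
        (f := fun z : H × H => (f (x + s • X z.1 + h • X z.2), g (y + s • Y z.1 + h • Y z.2)))
        ((hf.cont.comp (by fun_prop)).prodMk (hg.cont.comp (by fun_prop)))
        fun v => ⟨hf.mem _, hg.mem _⟩
    have hGi := integrable_of_continuous_of_bounded (μ.prod μ) hGc (C := 1) fun v => hJ1 _ _
    have hJi : Integrable (fun v => J (smoothAvg γ h f (x + s • X v)) (smoothAvg γ h g (y + s • Y v)))
        μ := by
      have := hcont _ _ (hf.avg (γ := γ) (h := h) hε) (hg.avg (γ := γ) (h := h) hε) x y
      have := this.comp (continuous_const_smul s)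
      simp only [Function.comp_def, map_smul] at this
      exact integrable_of_continuous_of_bounded μ this (C := 1) fun v => hJ1 _ _
    have h3 := integral_mono (f := fun v =>
      J (smoothAvg γ h f (x + s • X v)) (smoothAvg γ h g (y + s • Y v)) - K)
      (hJi.sub (integrable_const K)) hGi.integral_prod_left
      fun v => hstep f g hf hg (x + s • X v) (y + s • Y v)
    rw [integral_sub hJi (integrable_const _)] at h3
    simp only [integral_const, probReal_univ, one_smul] at h3
    refine le_trans ?_ h3
    push_cast at h1 ⊢
    linarith

/-- Two-function inequality for correlated pairs. -/
theorem CorrelatedPair.le_integral (hP : CorrelatedPair γ μ X Y ρ) (hγ : IsStableTwo γ)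
    (hμ : IsStableTwo μ) {J : ℝ → ℝ → ℝ} {ε C L : ℝ}
    (hρ : 0 ≤ ρ) (hρ1 : ρ ≤ 1) (hC : 0 ≤ C) (hL : 0 ≤ L) (hε : 0 ≤ ε)
    (hT : TaylorBound J (Icc ε (1 - ε)) ρ C)
    (hJc : ContinuousOn (fun u : ℝ × ℝ => J u.1 u.2) (Icc ε (1 - ε) ×ˢ Icc ε (1 - ε)))
    (hJ1 : ∀ x y, |J x y| ≤ 1) {f g : E → ℝ} (hf : SmoothClass ε L f) (hg : SmoothClass ε L g) :
    J (∫ u, f u ∂γ) (∫ u, g u ∂γ) ≤ ∫ v, J (f (X v)) (g (Y v)) ∂μ := by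
  obtain ⟨K, hK⟩ := hP.step hρ hρ1 hC hL hε hT hJc hJ1
  have key : ∀ k : ℕ, 0 < k → J (∫ u, f u ∂γ) (∫ u, g u ∂γ) - K / Real.sqrt k ≤
      ∫ v, J (f (X v)) (g (Y v)) ∂μ := by
    intro k hk
    have hk0 : (0 : ℝ) < k := Nat.cast_pos.2 hk
    have hsk : 1 ≤ Real.sqrt k := Real.one_le_sqrt.2 (by exact_mod_cast hk)
    have hsk0 : 0 < Real.sqrt k := by linarith
    have := CorrelatedPair.iterate (K := K * ((Real.sqrt k)⁻¹) ^ 3) hγ hμ hε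
      (inv_nonneg.2 (Real.sqrt_nonneg k)) hJc hJ1
      (fun f g hf hg => hK f g hf hg _ (inv_nonneg.2 (Real.sqrt_nonneg k)) (inv_le_one_of_one_le₀ hsk))
      k f g hf hg 0 0
    rw [mul_inv_cancel₀ hsk0.ne'] at this
    simp only [smoothAvg, zero_add, one_smul] at this
    have e : (k : ℝ) * (K * ((Real.sqrt k)⁻¹) ^ 3) = K / Real.sqrt k := by
      have : (k : ℝ) = Real.sqrt k ^ 2 := (Real.sq_sqrt hk0.le).symm
      nth_rewrite 1 [this]
      field_simp
    rwa [e] at this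
  have ht : Tendsto (fun k : ℕ => J (∫ u, f u ∂γ) (∫ u, g u ∂γ) - K / Real.sqrt k) atTop
      (𝓝 (J (∫ u, f u ∂γ) (∫ u, g u ∂γ) - 0)) := by
    refine tendsto_const_nhds.sub (Tendsto.div_atTop tendsto_const_nhds ?_)
    exact Real.tendsto_sqrt_atTop.comp tendsto_natCast_atTop_atTop
  rw [sub_zero] at ht
  exact le_of_tendsto ht ((eventually_gt_atTop 0).mono key)

end Correlated

lemma integral_linear_comb {Ω : Type*} [MeasurableSpace Ω] {μ : Measure Ω} {u v w : Ω → ℝ}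
    (hu : Integrable u μ) (hv : Integrable v μ) (hw : Integrable w μ) (a b c : ℝ) :
    ∫ x, (a * u x + b * v x + c * w x) ∂μ = a * ∫ x, u x ∂μ + b * ∫ x, v x ∂μ + c * ∫ x, w x ∂μ := by
  have h1 : Integrable (fun x => a * u x + b * v x) μ := (hu.const_mul a).add (hv.const_mul b)
  rw [integral_add h1 (hw.const_mul c), integral_add (hu.const_mul a) (hv.const_mul b),
    integral_const_mul, integral_const_mul, integral_const_mul]

section CenteredGaussian

variable {F : Type*} [NormedAddCommGroup F] [NormedSpace ℝ F] [CompleteSpace F]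
  [SecondCountableTopology F] [MeasurableSpace F] [BorelSpace F] {γ : Measure F} [IsGaussian γ]

lemma map_smul_add_smul (hγ : γ[id] = 0) (s t : ℝ) :
    (γ.prod γ).map (fun z => s • z.1 + t • z.2) = γ.map fun v => Real.sqrt (s ^ 2 + t ^ 2) • v := by
  set z : ℂ := ⟨s, t⟩ with hz
  have hr : ‖z‖ = Real.sqrt (s ^ 2 + t ^ 2) := by
    rw [Complex.norm_def, Complex.normSq_apply]
    congr 1
    simp [hz]
    ring
  have hs : ‖z‖ * Real.cos z.arg = s := by rw [Complex.norm_mul_cos_arg]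
  have ht : ‖z‖ * Real.sin z.arg = t := by rw [Complex.norm_mul_sin_arg]
  have hrot := IsGaussian.map_rotation_eq_self hγ z.arg
  have hfst : (γ.prod γ).map Prod.fst = γ := by simp [Measure.map_fst_prod]
  have h1 : (fun w : F × F => s • w.1 + t • w.2)
      = (fun v => ‖z‖ • v) ∘ Prod.fst ∘ (ContinuousLinearMap.rotation z.arg : F × F →L[ℝ] F × F) := by
    funext w
    simp only [Function.comp_apply, ContinuousLinearMap.rotation_apply, smul_add, smul_smul, hs, ht]
  rw [h1, ← Measure.map_map (by fun_prop) (by fun_prop), ← Measure.map_map (by fun_prop) (by fun_prop),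
    hrot, hfst, hr]

lemma isStableTwo_of_isGaussian (hγ : γ[id] = 0) : IsStableTwo γ :=
  fun s t _ _ => map_smul_add_smul hγ s t

lemma isGaussian_integral_dual (hγ : γ[id] = 0) (p : F →L[ℝ] ℝ) : ∫ v, p v ∂γ = 0 := by
  have := p.integral_comp_id_comm (μ := γ) IsGaussian.integrable_id
  simp only [id] at hγ
  rw [this, hγ, map_zero]

omit [CompleteSpace F] [SecondCountableTopology F] in
lemma integrable_dual_mul_dual (p r : F →L[ℝ] ℝ) : Integrable (fun v => p v * r v) γ :=
  (IsGaussian.memLp_dual γ p 2 (by simp)).integrable_mul (IsGaussian.memLp_dual γ r 2 (by simp))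

/-- The second marginal of a pair of Gaussian vectors with correlation `ρ`. -/
noncomputable def correlate (F : Type*) [NormedAddCommGroup F] [NormedSpace ℝ F] (ρ c : ℝ) :
    F × F →L[ℝ] F :=
  ρ • ContinuousLinearMap.fst ℝ F F + c • ContinuousLinearMap.snd ℝ F F

omit [CompleteSpace F] [SecondCountableTopology F] [MeasurableSpace F] [BorelSpace F] in
lemma correlate_apply (ρ c : ℝ) (z : F × F) : correlate F ρ c z = ρ • z.1 + c • z.2 := rfl

lemma map_correlate (hγ : γ[id] = 0) {ρ c : ℝ} (hρ : 0 ≤ ρ) (hc : 0 ≤ c) (h : ρ ^ 2 + c ^ 2 = 1) :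
    (γ.prod γ).map (correlate F ρ c) = γ := by
  have := isStableTwo_of_isGaussian hγ ρ c hρ hc
  rw [h, Real.sqrt_one] at this
  simp only [one_smul, Measure.map_id'] at this
  exact this

lemma integral_id_prod (hγ : γ[id] = 0) : (γ.prod γ)[id] = 0 := by
  have hi : Integrable (fun v : F => v) γ := IsGaussian.integrable_id
  have hi2 : Integrable (id : F × F → F × F) (γ.prod γ) := IsGaussian.integrable_id
  have h0 : ∫ v, v ∂γ = 0 := hγ
  ext
  · rw [fst_integral hi2]
    have := integral_fun_fst (μ := γ) (ν := γ) (fun v : F => v)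
    simpa [h0] using this
  · rw [snd_integral hi2]
    have := integral_fun_snd (μ := γ) (ν := γ) (fun v : F => v)
    simpa [h0] using this

lemma correlatedPair_correlate (hγ : γ[id] = 0) {ρ c : ℝ} (hρ : 0 ≤ ρ) (hc : 0 ≤ c)
    (h : ρ ^ 2 + c ^ 2 = 1) :
    CorrelatedPair γ (γ.prod γ) (ContinuousLinearMap.fst ℝ F F) (correlate F ρ c) ρ where
  map_left := by
    change (γ.prod γ).map Prod.fst = γ
    simp [Measure.map_fst_prod]
  map_right := map_correlate hγ hρ hc h
  integrable_pow k := by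
    rcases Nat.eq_zero_or_pos k with rfl | hk
    · simp
    · exact (IsGaussian.memLp_id (γ.prod γ) k (by simp)).integrable_norm_pow hk.ne'
  integral_apply p := isGaussian_integral_dual (integral_id_prod hγ) p
  quad_nonneg p r := by
    set Y := correlate F ρ c
    have hY : (γ.prod γ).map Y = γ := map_correlate hγ hρ hc h
    have hX : (γ.prod γ).map Prod.fst = γ := by simp [Measure.map_fst_prod]
    have e1 : ∫ v, p v.1 ^ 2 ∂(γ.prod γ) = ∫ v, p v * p v ∂γ := by
      conv_rhs => rw [← hX]
      rw [integral_map (by fun_prop) (by fun_prop)]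
      simp [sq]
    have e2 : ∫ v, r (Y v) ^ 2 ∂(γ.prod γ) = ∫ v, r v * r v ∂γ := by
      conv_rhs => rw [← hY]
      rw [integral_map (by fun_prop) (by fun_prop)]
      simp [sq]
    have i1 : Integrable (fun v : F × F => p v.1 * p v.1) (γ.prod γ) :=
      integrable_dual_mul_dual (p.comp (ContinuousLinearMap.fst ℝ F F)) (p.comp (ContinuousLinearMap.fst ℝ F F))
    have i2 : Integrable (fun v : F × F => r (Y v) * r (Y v)) (γ.prod γ) :=
      integrable_dual_mul_dual (r.comp Y) (r.comp Y)
    have i3 : Integrable (fun v : F × F => p v.1 * r (Y v)) (γ.prod γ) :=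
      integrable_dual_mul_dual (p.comp (ContinuousLinearMap.fst ℝ F F)) (r.comp Y)
    have i4 : Integrable (fun v : F × F => p v.1 * r v.1) (γ.prod γ) :=
      integrable_dual_mul_dual (p.comp (ContinuousLinearMap.fst ℝ F F)) (r.comp (ContinuousLinearMap.fst ℝ F F))
    have i5 : Integrable (fun v : F × F => p v.1 * r v.2) (γ.prod γ) :=
      integrable_dual_mul_dual (p.comp (ContinuousLinearMap.fst ℝ F F)) (r.comp (ContinuousLinearMap.snd ℝ F F))
    have e3 : ∫ v, p v.1 * r (Y v) ∂(γ.prod γ) = ρ * ∫ v, p v * r v ∂γ := by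
      have h1 : ∀ v : F × F, p v.1 * r (Y v) = ρ * (p v.1 * r v.1) + c * (p v.1 * r v.2) := by
        intro v
        simp only [Y, correlate_apply, map_add, map_smul, smul_eq_mul]
        ring
      simp_rw [h1]
      rw [integral_add (i4.const_mul _) (i5.const_mul _), integral_const_mul, integral_const_mul,
        integral_prod_mul (fun v => p v) (fun v => r v), isGaussian_integral_dual hγ p]
      simp only [zero_mul, mul_zero, add_zero]
      congr 1
      conv_rhs => rw [← hX]
      rw [integral_map (by fun_prop) (by fun_prop)]
    have e4 : ∫ v : F × F, (ρ * p v.1 ^ 2 + 2 * p v.1 * r (Y v) + ρ * r (Y v) ^ 2) ∂(γ.prod γ)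
        = ρ * ∫ v, (p v + r v) ^ 2 ∂γ := by
      have h1 := integral_linear_comb i1 i3 i2 ρ 2 ρ
      have h2 := integral_linear_comb (integrable_dual_mul_dual (γ := γ) p p)
        (integrable_dual_mul_dual p r) (integrable_dual_mul_dual r r) 1 2 1
      simp only [← sq] at h1 h2 e1 e2
      rw [e1, e2, e3] at h1
      calc _ = ∫ v : F × F, (ρ * p v.1 ^ 2 + 2 * (p v.1 * r (Y v)) + ρ * r (Y v) ^ 2) ∂(γ.prod γ) := by
            simp only [mul_assoc]
        _ = ρ * ∫ v, (1 * p v ^ 2 + 2 * (p v * r v) + 1 * r v ^ 2) ∂γ := by rw [h1, h2]; ring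
        _ = _ := by congr 2; funext v; ring
    simp only [ContinuousLinearMap.coe_fst']
    rw [e4]
    exact mul_nonneg hρ (integral_nonneg fun v => sq_nonneg _)

end CenteredGaussian

lemma continuousOn_biCopula {ρ c ε : ℝ} (hc : 0 < c) (h : ρ ^ 2 + c ^ 2 = 1) (hε : 0 < ε) :
    ContinuousOn (fun u : ℝ × ℝ => biCopula ρ c u.1 u.2) (Icc ε (1 - ε) ×ˢ Icc ε (1 - ε)) := by
  intro u hu
  have h1 : ContinuousAt stdQuantile u.1 := continuousAt_stdQuantile ⟨by linarith [hu.1.1], by linarith [hu.1.2]⟩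
  have h2 : ContinuousAt stdQuantile u.2 := continuousAt_stdQuantile ⟨by linarith [hu.2.1], by linarith [hu.2.2]⟩
  have h3 := (hasFDerivAt_biPhi hc h (stdQuantile u.1, stdQuantile u.2)).continuousAt
  have h4 : ContinuousAt (fun u : ℝ × ℝ => (stdQuantile u.1, stdQuantile u.2)) u :=
    (h1.comp continuousAt_fst).prodMk (h2.comp continuousAt_snd)
  exact (ContinuousAt.comp (f := fun u : ℝ × ℝ => (stdQuantile u.1, stdQuantile u.2)) h3 h4).continuousWithinAt

lemma abs_biCopula_le_one (ρ c x y : ℝ) : |biCopula ρ c x y| ≤ 1 := by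
  rw [biCopula, abs_of_nonneg (biPhi_nonneg _ _)]
  exact (biPhi_le_left _ _).trans (stdPhi_le_one _)

/-- A functional form of Gaussian noise stability, bounding the correlation of two functions from
below by that of two opposite half-lines. -/
theorem biCopula_integral_le {F : Type*} [NormedAddCommGroup F] [NormedSpace ℝ F] [CompleteSpace F]
    [SecondCountableTopology F] [MeasurableSpace F] [BorelSpace F] {γ : Measure F} [IsGaussian γ]
    (hγ : γ[id] = 0) {ρ c ε L : ℝ} (hρ : 0 < ρ) (hc : 0 < c) (h : ρ ^ 2 + c ^ 2 = 1) (hε : 0 < ε)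
    (hL : 0 ≤ L) {f g : F → ℝ} (hf : SmoothClass ε L f) (hg : SmoothClass ε L g) :
    biCopula ρ c (∫ u, f u ∂γ) (∫ u, g u ∂γ)
      ≤ ∫ v : F × F, biCopula ρ c (f v.1) (g (ρ • v.1 + c • v.2)) ∂(γ.prod γ) := by
  obtain ⟨C, hC, hT⟩ := taylorBound_biCopula hρ hc h hε
  exact (correlatedPair_correlate hγ hρ.le hc.le h).le_integral (isStableTwo_of_isGaussian hγ)
    (isStableTwo_of_isGaussian (integral_id_prod hγ)) hρ.le (by nlinarith [sq_nonneg c]) hC hL hε.le hT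
    (continuousOn_biCopula hc h hε) (abs_biCopula_le_one ρ c) hf hg

section Bump

variable {E : Type*} [NormedAddCommGroup E] [NormedSpace ℝ E]

lemma SmoothClass.of_contDiff {f : E → ℝ} (hf : ContDiff ℝ 2 f) (hs : HasCompactSupport f)
    (h01 : ∀ x, f x ∈ Icc 0 1) : ∃ L : ℝ, 0 ≤ L ∧ ∀ ε : ℝ, 0 < ε → ε < 1 / 2 →
      SmoothClass ε L (fun x => ε + (1 - 2 * ε) * f x) := by
  have hD : ContDiff ℝ 1 (fderiv ℝ f) := hf.fderiv_right (by norm_num)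
  obtain ⟨M, hM⟩ := hD.lipschitzWith_of_hasCompactSupport (hs.fderiv ℝ) one_ne_zero
  obtain ⟨B, hB⟩ := (hs.fderiv ℝ).exists_bound_of_continuous hD.continuous
  have hB0 : 0 ≤ B := (norm_nonneg _).trans (hB 0)
  have hdf : ∀ x, HasFDerivAt f (fderiv ℝ f x) x := fun x =>
    (hf.differentiable (by norm_num) x).hasFDerivAt
  refine ⟨B + M, by positivity, fun ε hε hε2 => ⟨fun x => ?_, ?_, fun x => (1 - 2 * ε) • fderiv ℝ f x, ?_, fun x => ⟨?_, fun v => ?_⟩⟩⟩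
  · have h := h01 x
    constructor <;> nlinarith [h.1, h.2]
  · exact continuous_const.add (continuous_const.mul hf.continuous)
  · exact hD.continuous.const_smul (1 - 2 * ε)
  · rw [norm_smul, Real.norm_eq_abs, abs_of_pos (by linarith)]
    have := hB x
    nlinarith [norm_nonneg (fderiv ℝ f x), M.coe_nonneg]
  · have h1 : ‖f (x + v) - f x - fderiv ℝ f x (x + v - x)‖ ≤ (M * ‖v‖) * ‖x + v - x‖ := by
      refine Convex.norm_image_sub_le_of_norm_hasFDerivWithin_le' (s := segment ℝ x (x + v))
        (f' := fderiv ℝ f)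
        (fun z _ => (hdf z).hasFDerivWithinAt) (fun z hz => ?_) (convex_segment _ _)
        (left_mem_segment _ _ _) (right_mem_segment _ _ _)
      have h2 : ‖z - x‖ ≤ ‖v‖ := by
        have := norm_sub_le_of_mem_segment hz
        simpa using this
      calc ‖fderiv ℝ f z - fderiv ℝ f x‖ ≤ M * ‖z - x‖ := by
            simpa [dist_eq_norm] using hM.dist_le_mul z x
        _ ≤ _ := by gcongr
    rw [add_sub_cancel_left, Real.norm_eq_abs] at h1
    have h3 : ε + (1 - 2 * ε) * f (x + v) - (ε + (1 - 2 * ε) * f x) - ((1 - 2 * ε) • fderiv ℝ f x) v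
        = (1 - 2 * ε) * (f (x + v) - f x - fderiv ℝ f x v) := by
      simp; ring
    rw [h3, abs_mul, abs_of_pos (by linarith)]
    have h4 : 0 ≤ B * ‖v‖ ^ 2 := by positivity
    have h5 := abs_nonneg (f (x + v) - f x - fderiv ℝ f x v)
    nlinarith

lemma SmoothClass.mono {ε L L' : ℝ} {f : E → ℝ} (hf : SmoothClass ε L f) (h : L ≤ L') :
    SmoothClass ε L' f := by
  obtain ⟨D, hD, hD'⟩ := hf.exists_deriv
  exact ⟨hf.mem, hf.cont, D, hD, fun x => ⟨(hD' x).1.trans h, fun v => ((hD' x).2 v).trans (by gcongr)⟩⟩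

lemma exists_bump [FiniteDimensional ℝ E] {K : Set E} (hK : IsCompact K) {η : ℝ} (hη : 0 < η) :
    ∃ f : E → ℝ, ContDiff ℝ 2 f ∧ HasCompactSupport f ∧ (∀ x, f x ∈ Icc 0 1) ∧ (∀ x ∈ K, f x = 1) ∧
      ∀ x, f x ≠ 0 → x ∈ Metric.thickening η K := by
  have : ProperSpace E := FiniteDimensional.proper ℝ E
  obtain ⟨f, h0, h1, h01⟩ := exists_contMDiffMap_zero_one_of_isClosed (n := 2) (modelWithCornersSelf ℝ E)
    (Metric.isOpen_thickening (δ := η) (E := K)).isClosed_compl hK.isClosed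
    (disjoint_compl_left_iff_subset.2 (Metric.self_subset_thickening hη K))
  have hsupp : ∀ x, f x ≠ 0 → x ∈ Metric.thickening η K := fun x hx => by
    by_contra h
    exact hx (h0 h)
  refine ⟨f, f.contMDiff.contDiff, ?_, h01, fun x hx => h1 hx, hsupp⟩
  have hb : Bornology.IsBounded (Metric.thickening η K) := hK.isBounded.thickening
  exact HasCompactSupport.of_support_subset_isCompact hb.isCompact_closure
    fun x hx => subset_closure (hsupp x hx)

variable [FiniteDimensional ℝ E] [MeasurableSpace E] [BorelSpace E]
  {γ : Measure E}

omit [NormedSpace ℝ E] [FiniteDimensional ℝ E] in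
lemma measureReal_le_integral_of_bump [IsProbabilityMeasure γ] {f : E → ℝ} (hi : Integrable f γ)
    (h01 : ∀ x, f x ∈ Icc 0 1) {K : Set E} (hK : IsCompact K) (h1 : ∀ x ∈ K, f x = 1) :
    γ.real K ≤ ∫ x, f x ∂γ := by
  rw [← integral_indicator_one hK.measurableSet]
  refine integral_mono ((integrable_indicator_iff hK.measurableSet).2 (integrable_const _).integrableOn) hi fun x => ?_
  by_cases hx : x ∈ K
  · simp [hx, h1 x hx]
  · simpa [hx] using (h01 x).1

/-- Two separated compact sets are rarely hit simultaneously by correlated Gaussian vectors, yet at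
least as often as two opposite half-lines. -/
lemma biPhi_le_measure_of_separated [IsGaussian γ] (hγ : γ[id] = 0) {ρ c : ℝ} (hρ : 0 < ρ) (hc : 0 < c)
    (h : ρ ^ 2 + c ^ 2 = 1) {K K' : Set E} (hK : IsCompact K) (hK' : IsCompact K') {r r' a b a' b' : ℝ}
    (hr : ∀ x ∈ K, ∀ y ∈ K', r ≤ ‖x - y‖) (hr' : r' < r) (ha : stdPhi a ≤ γ.real K)
    (hb : stdPhi b ≤ γ.real K') (ha' : a' < a) (hb' : b' < b) :
    biPhi ρ c a' b' ≤ (γ.prod γ).real {v : E × E | r' ≤ ‖v.1 - (ρ • v.1 + c • v.2)‖} := by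
  have hp : IsProbabilityMeasure γ := IsGaussian.toIsProbabilityMeasure γ
  set P := (γ.prod γ).real {v : E × E | r' ≤ ‖v.1 - (ρ • v.1 + c • v.2)‖}
  obtain ⟨f, hf, hfs, hf01, hf1, hf0⟩ := exists_bump hK (η := (r - r') / 2) (by linarith)
  obtain ⟨g, hg, hgs, hg01, hg1, hg0⟩ := exists_bump hK' (η := (r - r') / 2) (by linarith)
  obtain ⟨L, hL0, hL⟩ := SmoothClass.of_contDiff hf hfs hf01
  obtain ⟨L', hL0', hL'⟩ := SmoothClass.of_contDiff hg hgs hg01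
  have hfi := integrable_of_continuous_of_bounded γ hf.continuous (C := 1) fun x => by
    rw [Real.norm_eq_abs, abs_of_nonneg (hf01 x).1]; exact (hf01 x).2
  have hgi := integrable_of_continuous_of_bounded γ hg.continuous (C := 1) fun x => by
    rw [Real.norm_eq_abs, abs_of_nonneg (hg01 x).1]; exact (hg01 x).2
  have hmf := ha.trans (measureReal_le_integral_of_bump hfi hf01 hK hf1)
  have hmg := hb.trans (measureReal_le_integral_of_bump hgi hg01 hK' hg1)
  have hmf1 : ∫ x, f x ∂γ ≤ 1 := by
    simpa using integral_mono hfi (integrable_const 1) fun x => (hf01 x).2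
  have hmg1 : ∫ x, g x ∂γ ≤ 1 := by
    simpa using integral_mono hgi (integrable_const 1) fun x => (hg01 x).2
  have hS : MeasurableSet {v : E × E | r' ≤ ‖v.1 - (ρ • v.1 + c • v.2)‖} :=
    measurableSet_le (by fun_prop) (by fun_prop)
  have key : ∀ u u' m ε : ℝ, stdPhi u ≤ m → stdPhi u' < stdPhi u → m ≤ 1 → 0 < ε → ε < 1 / 2 →
      ε ≤ (stdPhi u - stdPhi u') / 2 → u' ≤ stdQuantile (ε + (1 - 2 * ε) * m) := by
    intro u u' m ε h1 h2 h3 h4 h5 h6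
    have h7 := stdPhi_nonneg u
    have h8 := stdPhi_le_one u
    rw [← strictMono_stdPhi.le_iff_le, stdPhi_stdQuantile ⟨by nlinarith, by nlinarith⟩]
    nlinarith
  have hsa := strictMono_stdPhi ha'
  have hsb := strictMono_stdPhi hb'
  refine le_of_forall_pos_le_add fun ε₀ hε₀ => ?_
  obtain ⟨ε, hε, hεm⟩ := exists_between (show (0 : ℝ) < min ε₀ (min (1 / 2) (min ((stdPhi a - stdPhi a') / 2)
    ((stdPhi b - stdPhi b') / 2))) from lt_min hε₀ (lt_min (by norm_num)
      (lt_min (by linarith) (by linarith))))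
  simp only [lt_min_iff] at hεm
  obtain ⟨hε1, hε2, hε3, hε4⟩ := hεm
  have hstab := biCopula_integral_le hγ hρ hc h hε (L := max L L') (hL0.trans (le_max_left _ _))
    ((hL ε hε hε2).mono (le_max_left _ _)) ((hL' ε hε hε2).mono (le_max_right _ _))
  have hInt : ∀ {f : E → ℝ}, Integrable f γ →
      ∫ x, (ε + (1 - 2 * ε) * f x) ∂γ = ε + (1 - 2 * ε) * ∫ x, f x ∂γ := by
    intro f hf
    rw [integral_add (integrable_const _) (hf.const_mul _), integral_const_mul]
    simp
  rw [hInt hfi, hInt hgi] at hstab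
  have hlow : biPhi ρ c a' b' ≤ biCopula ρ c (ε + (1 - 2 * ε) * ∫ x, f x ∂γ)
      (ε + (1 - 2 * ε) * ∫ x, g x ∂γ) :=
    (biPhi_mono_left b' (key a a' _ ε hmf hsa hmf1 hε hε2 hε3.le)).trans
      (biPhi_mono_right hc h _ (key b b' _ ε hmg hsb hmg1 hε hε2 hε4.le))
  refine hlow.trans (hstab.trans ?_)
  calc _ ≤ ∫ v, (ε + indicator {v : E × E | r' ≤ ‖v.1 - (ρ • v.1 + c • v.2)‖} (1 : E × E → ℝ) v) ∂(γ.prod γ) := by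
        refine integral_mono_of_nonneg (ae_of_all _ fun v => biPhi_nonneg _ _)
          ((integrable_const _).add ((integrable_indicator_iff hS).2 (integrable_const _).integrableOn))
          (ae_of_all _ fun v => ?_)
        have hone : stdPhi (stdQuantile ε) = ε := stdPhi_stdQuantile ⟨hε, by linarith⟩
        simp only [biCopula]
        by_cases hf' : f v.1 = 0
        · have h1 : (0 : ℝ) ≤ indicator {v : E × E | r' ≤ ‖v.1 - (ρ • v.1 + c • v.2)‖} (1 : E × E → ℝ) v :=
            indicator_nonneg (fun _ _ => zero_le_one) _
          rw [hf', mul_zero, add_zero]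
          linarith [biPhi_le_left (ρ := ρ) (c := c) (stdQuantile ε)
            (stdQuantile (ε + (1 - 2 * ε) * g (ρ • v.1 + c • v.2)))]
        by_cases hg' : g (ρ • v.1 + c • v.2) = 0
        · have h1 : (0 : ℝ) ≤ indicator {v : E × E | r' ≤ ‖v.1 - (ρ • v.1 + c • v.2)‖} (1 : E × E → ℝ) v :=
            indicator_nonneg (fun _ _ => zero_le_one) _
          rw [hg', mul_zero, add_zero]
          linarith [biPhi_le_right hc (stdQuantile (ε + (1 - 2 * ε) * f v.1)) (stdQuantile ε) h]
        · have hv : v ∈ {v : E × E | r' ≤ ‖v.1 - (ρ • v.1 + c • v.2)‖} := by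
            obtain ⟨x, hx, hxv⟩ := Metric.mem_thickening_iff.1 (hf0 _ hf')
            obtain ⟨y, hy, hyv⟩ := Metric.mem_thickening_iff.1 (hg0 _ hg')
            have h1 := hr x hx y hy
            rw [← dist_eq_norm] at h1
            have h2 := dist_triangle4 x v.1 (ρ • v.1 + c • v.2) y
            rw [dist_comm x v.1] at h2
            change r' ≤ ‖_‖
            rw [← dist_eq_norm]
            linarith
          rw [indicator_of_mem hv, Pi.one_apply]
          linarith [(biPhi_le_left (ρ := ρ) (c := c) (stdQuantile (ε + (1 - 2 * ε) * f v.1))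
            (stdQuantile (ε + (1 - 2 * ε) * g (ρ • v.1 + c • v.2)))).trans (stdPhi_le_one _)]
    _ = ε + P := by
        rw [integral_add (integrable_const _)
          ((integrable_indicator_iff hS).2 (integrable_const _).integrableOn), integral_indicator_one hS]
        simp [P]
    _ ≤ P + ε₀ := by linarith

end Bump

section Tail

variable {ι : Type*} [Fintype ι]

lemma integrable_exp_sq_gaussianReal {θ : ℝ} (hθ : θ < 1) :
    Integrable (fun x : ℝ => Real.exp (θ / 2 * x ^ 2)) (gaussianReal 0 1) := by
  rw [gaussianReal_of_var_ne_zero _ one_ne_zero, integrable_withDensity_iff_integrable_smul'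
    (measurable_gaussianPDF _ _) (ae_of_all _ fun _ => gaussianPDF_lt_top)]
  have h := (integrable_exp_neg_mul_sq (b := (1 - θ) / 2) (by linarith)).const_mul ((Real.sqrt (2 * Real.pi))⁻¹)
  refine h.congr (ae_of_all _ fun x => ?_)
  simp only [toReal_gaussianPDF, gaussianPDFReal_zero_one, stdPdf, smul_eq_mul]
  rw [mul_assoc, ← Real.exp_add]
  congr 2
  ring

lemma integrable_exp_sq_norm_stdGaussian {θ : ℝ} (hθ : θ < 1) :
    Integrable (fun z => Real.exp (θ / 2 * ‖z‖ ^ 2)) (stdGaussian (EuclideanSpace ℝ ι)) := by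
  rw [← map_pi_eq_stdGaussian, integrable_map_measure (by fun_prop) (by fun_prop)]
  have h := Integrable.fintype_prod (ι := ι) (𝕜 := ℝ) (f := fun _ x => Real.exp (θ / 2 * x ^ 2))
    (μ := fun _ => gaussianReal 0 1) fun _ => integrable_exp_sq_gaussianReal hθ
  refine h.congr (ae_of_all _ fun x => ?_)
  simp only [Function.comp_apply]
  rw [EuclideanSpace.real_norm_sq_eq, ← Real.exp_sum, Finset.mul_sum]

lemma measure_norm_sub_correlate_le {θ : ℝ} (hθ0 : 0 ≤ θ) (hθ : θ < 1) : ∃ C : ℝ, 0 < C ∧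
    ∀ r' ρ c : ℝ, 0 ≤ r' → 0 ≤ ρ → 0 < c → ρ ^ 2 + c ^ 2 = 1 →
      ((stdGaussian (EuclideanSpace ℝ ι)).prod (stdGaussian (EuclideanSpace ℝ ι))).real
        {v | r' ≤ ‖v.1 - (ρ • v.1 + c • v.2)‖} ≤
      C * Real.exp (θ * r' ^ 2 / 4) * Real.exp (-(θ * r' ^ 2 / (2 * c ^ 2))) := by
  set γ := stdGaussian (EuclideanSpace ℝ ι)
  have hInt := integrable_exp_sq_norm_stdGaussian (ι := ι) hθ
  refine ⟨∫ z, Real.exp (θ / 2 * ‖z‖ ^ 2) ∂γ, integral_exp_pos hInt, fun r' ρ c hr' hρ hc h => ?_⟩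
  set τ := Real.sqrt ((1 - ρ) ^ 2 + (-c) ^ 2) with hτ
  have hτ2 : τ ^ 2 = 2 * (1 - ρ) := by
    rw [hτ, Real.sq_sqrt (by positivity)]
    nlinarith
  have hρ1 : ρ < 1 := by nlinarith
  have hτ0 : 0 < τ := Real.sqrt_pos.2 (by nlinarith [sq_nonneg (1 - ρ)])
  have h1 : {v : EuclideanSpace ℝ ι × EuclideanSpace ℝ ι | r' ≤ ‖v.1 - (ρ • v.1 + c • v.2)‖}
      = (fun z => (1 - ρ) • z.1 + (-c) • z.2) ⁻¹' {w | r' ≤ ‖w‖} := by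
    ext v
    have : v.1 - (ρ • v.1 + c • v.2) = (1 - ρ) • v.1 + (-c) • v.2 := by module
    change r' ≤ ‖_‖ ↔ r' ≤ ‖_‖
    rw [this]
  have hm : MeasurableSet {w : EuclideanSpace ℝ ι | r' ≤ ‖w‖} := measurableSet_le (by fun_prop) (by fun_prop)
  rw [h1, ← map_measureReal_apply (by fun_prop) hm,
    map_smul_add_smul (by simp [γ]) (1 - ρ) (-c), map_measureReal_apply (by fun_prop) hm, ← hτ]
  have hmark := mul_meas_ge_le_integral_of_nonneg (μ := γ) (ae_of_all _ fun z => (Real.exp_pos (θ / 2 * ‖z‖ ^ 2)).le)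
    hInt (Real.exp (θ / 2 * (r' / τ) ^ 2))
  have hsub : (fun v : EuclideanSpace ℝ ι => τ • v) ⁻¹' {w | r' ≤ ‖w‖}
      ⊆ {x | Real.exp (θ / 2 * (r' / τ) ^ 2) ≤ Real.exp (θ / 2 * ‖x‖ ^ 2)} := by
    intro v hv
    have hv' : r' ≤ ‖τ • v‖ := hv
    rw [norm_smul, Real.norm_eq_abs, abs_of_pos hτ0] at hv'
    have : r' / τ ≤ ‖v‖ := by rw [div_le_iff₀ hτ0]; linarith
    refine Real.exp_le_exp.2 ?_
    gcongr
  have h2 : θ * r' ^ 2 / (2 * c ^ 2) - θ * r' ^ 2 / 4 ≤ θ / 2 * (r' / τ) ^ 2 := by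
    have e1 : θ / 2 * (r' / τ) ^ 2 = θ * r' ^ 2 * ((1 + ρ) / (4 * c ^ 2)) := by
      have : c ^ 2 = (1 - ρ) * (1 + ρ) := by linarith
      rw [div_pow, hτ2, this]
      have : 1 - ρ ≠ 0 := by linarith
      have : 1 + ρ ≠ 0 := by linarith
      field_simp
      ring
    have e2 : θ * r' ^ 2 / (2 * c ^ 2) - θ * r' ^ 2 / 4 = θ * r' ^ 2 * ((2 - c ^ 2) / (4 * c ^ 2)) := by
      field_simp
      ring
    rw [e1, e2]
    gcongr
    nlinarith
  calc γ.real _ ≤ γ.real {x | Real.exp (θ / 2 * (r' / τ) ^ 2) ≤ Real.exp (θ / 2 * ‖x‖ ^ 2)} :=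
        measureReal_mono hsub
    _ ≤ (∫ z, Real.exp (θ / 2 * ‖z‖ ^ 2) ∂γ) * Real.exp (-(θ / 2 * (r' / τ) ^ 2)) := by
        rw [Real.exp_neg, ← div_eq_mul_inv, le_div_iff₀ (Real.exp_pos _), mul_comm]
        exact hmark
    _ ≤ (∫ z, Real.exp (θ / 2 * ‖z‖ ^ 2) ∂γ) *
        (Real.exp (θ * r' ^ 2 / 4) * Real.exp (-(θ * r' ^ 2 / (2 * c ^ 2)))) := by
        rw [← Real.exp_add]
        refine mul_le_mul_of_nonneg_left (Real.exp_le_exp.2 ?_) (integral_exp_pos hInt).le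
        linarith
    _ = _ := by ring

end Tail

lemma stdPdf_le_stdPdf {s t : ℝ} (h : |s| ≤ t) : stdPdf t ≤ stdPdf s := by
  have : s ^ 2 ≤ t ^ 2 := sq_le_sq' (by linarith [(abs_le.1 h).1]) (abs_le.1 h).2
  unfold stdPdf
  gcongr

lemma mul_le_setIntegral_Iic {f : ℝ → ℝ} (hf : Integrable f) (h0 : ∀ s, 0 ≤ f s) {a ζ k : ℝ}
    (hζ : 0 ≤ ζ) (hk : ∀ s ∈ Icc (a - ζ) a, k ≤ f s) : ζ * k ≤ ∫ s in Iic a, f s := by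
  calc ζ * k = ∫ s in Icc (a - ζ) a, k := by
        rw [setIntegral_const, Real.volume_real_Icc_of_le (by linarith)]
        simp
    _ ≤ ∫ s in Icc (a - ζ) a, f s :=
        setIntegral_mono_on (by simp) hf.integrableOn measurableSet_Icc hk
    _ ≤ _ := setIntegral_mono_set hf.integrableOn (ae_of_all _ h0)
        (LE.le.eventuallyLE fun s hs => hs.2)

lemma stdPdf_le_stdPhi_neg {t : ℝ} (ht : 0 ≤ t) : stdPdf (t + 1) ≤ stdPhi (-t) := by
  rw [stdPhi_eq_integral, ← one_mul (stdPdf (t + 1))]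
  refine mul_le_setIntegral_Iic integrable_stdPdf (fun s => (stdPdf_pos s).le) zero_le_one fun s hs => ?_
  exact stdPdf_le_stdPdf (abs_le.2 ⟨by linarith [hs.1], by linarith [hs.2]⟩)

lemma le_biPhi {ρ c a b m ζ : ℝ} (hζ : 0 < ζ) (hζ1 : ζ ≤ 1) (hρ1 : ρ ≤ 1) (hc : 0 < c)
    (hm : 0 ≤ m) (hab : -m ≤ a + b) (hρζ : (1 - ρ) * (|a| + 1) ≤ ζ) :
    ζ * (stdPdf (|a| + 1) * stdPdf ((m + 2 * ζ) / c + 1)) ≤ biPhi ρ c a b := by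
  refine mul_le_setIntegral_Iic ?_ (fun s => mul_nonneg (stdPdf_pos s).le (stdPhi_nonneg _)) hζ.le
    fun s hs => ?_
  · exact integrable_stdPdf_mul (continuous_stdPhi.comp (by fun_prop)) fun t => norm_stdPhi_le_one _
  · have hs1 : |s| ≤ |a| + 1 := by
      have h1 : |s| ≤ |a| + |s - a| := by simpa using abs_add_le a (s - a)
      have h2 : |s - a| ≤ 1 := abs_le.2 ⟨by linarith [hs.1], by linarith [hs.2]⟩
      linarith
    have h3 : (1 - ρ) * s ≤ ζ := (mul_le_mul_of_nonneg_left ((le_abs_self s).trans hs1)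
      (by linarith)).trans hρζ
    have h4 : -((m + 2 * ζ) / c) ≤ (b + ρ * s) / c := by
      rw [← neg_div]
      gcongr
      linarith [hs.1]
    exact mul_le_mul (stdPdf_le_stdPdf hs1) ((stdPdf_le_stdPhi_neg (by positivity)).trans
      (strictMono_stdPhi.monotone h4)) (stdPdf_pos _).le (stdPdf_pos _).le

lemma le_of_exp_le {A C M N c₀ : ℝ} (hA : 0 < A) (hN : 0 ≤ N) (hM : 0 ≤ M) (hc₀ : 0 < c₀)
    (h : ∀ c : ℝ, 0 < c → c < c₀ →
      A * Real.exp (-((M / c + 1) ^ 2 / 2)) ≤ C * Real.exp (-(N ^ 2 / (2 * c ^ 2)))) : N ≤ M := by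
  by_contra! hlt
  have hC : 0 < C := by
    have h1 := h (c₀ / 2) (by linarith) (by linarith)
    have h2 : 0 < C * Real.exp (-(N ^ 2 / (2 * (c₀ / 2) ^ 2))) :=
      (mul_pos hA (Real.exp_pos _)).trans_le h1
    exact pos_of_mul_pos_left h2 (Real.exp_pos _).le
  set κ := (N - M) * N / 4 with hκ
  have hN' : 0 < N := hM.trans_lt hlt
  have hκ0 : 0 < κ := by have : 0 < N - M := by linarith
                         positivity
  obtain ⟨c, hc, hc'⟩ := exists_between (show 0 < min (min c₀ ((N - M) / 2)) (min 1 (A * κ / C)) from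
    lt_min (lt_min hc₀ (by linarith)) (lt_min one_pos (by positivity)))
  simp only [lt_min_iff] at hc'
  obtain ⟨⟨hc1, hc2⟩, hc3, hc4⟩ := hc'
  have h1 := h c hc hc1
  have h2 : κ / c ^ 2 ≤ N ^ 2 / (2 * c ^ 2) - (M / c + 1) ^ 2 / 2 := by
    have e : N ^ 2 / (2 * c ^ 2) - (M / c + 1) ^ 2 / 2 = ((N ^ 2 - (M + c) ^ 2) / 2) / c ^ 2 := by
      field_simp
    rw [e]
    gcongr
    nlinarith
  have h3 : A * Real.exp (κ / c ^ 2) ≤ C := by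
    have h4 : A * Real.exp (N ^ 2 / (2 * c ^ 2) - (M / c + 1) ^ 2 / 2) ≤ C := by
      have := mul_le_mul_of_nonneg_right h1 (Real.exp_pos (N ^ 2 / (2 * c ^ 2))).le
      rw [mul_assoc, mul_assoc, ← Real.exp_add, ← Real.exp_add, neg_add_cancel, Real.exp_zero, mul_one] at this
      rwa [sub_eq_neg_add]
    exact (mul_le_mul_of_nonneg_left (Real.exp_le_exp.2 h2) hA.le).trans h4
  have h5 : κ / c ^ 2 ≤ Real.exp (κ / c ^ 2) := by linarith [Real.add_one_le_exp (κ / c ^ 2)]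
  have h6 : κ / c ≤ κ / c ^ 2 := by
    gcongr
    nlinarith
  have h7 : A * (κ / c) ≤ C := (mul_le_mul_of_nonneg_left (h6.trans h5) hA.le).trans h3
  rw [lt_div_iff₀ hC] at hc4
  rw [← mul_div_assoc, div_le_iff₀ hc] at h7
  linarith

/-- The Gaussian isoperimetric inequality for a pair of separated compact sets. -/
theorem add_le_neg_of_separated {ι : Type*} [Fintype ι] {K K' : Set (EuclideanSpace ℝ ι)}
    (hK : IsCompact K) (hK' : IsCompact K') {r a b : ℝ} (hr0 : 0 < r)
    (hr : ∀ x ∈ K, ∀ y ∈ K', r ≤ ‖x - y‖)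
    (ha : stdPhi a ≤ (stdGaussian (EuclideanSpace ℝ ι)).real K)
    (hb : stdPhi b ≤ (stdGaussian (EuclideanSpace ℝ ι)).real K') : a + b ≤ -r := by
  by_contra! hlt
  obtain ⟨m, hm, hmr⟩ := exists_between (show max 0 (-(a + b)) < r from max_lt hr0 (by linarith))
  rw [max_lt_iff] at hm
  set t := (a + b + m) / 2 with ht
  have ht0 : 0 < t := by linarith [hm.2]
  obtain ⟨M, hMm, hMr⟩ := exists_between hmr
  obtain ⟨N, hNM, hNr⟩ := exists_between hMr
  obtain ⟨r', hr'N, hr'r⟩ := exists_between hNr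
  have hN0 : 0 < N := by linarith
  set θ := (N / r') ^ 2 with hθ
  have hr'0 : 0 < r' := by linarith
  have hθ1 : θ < 1 := by
    rw [hθ, div_pow, div_lt_one (by positivity)]
    gcongr
  have hθr : θ * r' ^ 2 = N ^ 2 := by rw [hθ, ← mul_pow, div_mul_cancel₀ _ hr'0.ne']
  obtain ⟨C, hC, hCle⟩ := measure_norm_sub_correlate_le (ι := ι) (sq_nonneg _) hθ1
  set ζ := min 1 ((M - m) / 2) with hζ
  have hζ0 : 0 < ζ := lt_min one_pos (by linarith)
  have hζ1 : ζ ≤ 1 := min_le_left _ _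
  have hζM : m + 2 * ζ ≤ M := by linarith [min_le_right 1 ((M - m) / 2)]
  refine absurd (le_of_exp_le (A := ζ * stdPdf (|a - t| + 1) * (Real.sqrt (2 * Real.pi))⁻¹)
    (C := C * Real.exp (θ * r' ^ 2 / 4)) (M := M) (N := N) (c₀ := min 1 (ζ / (|a - t| + 1)))
    (by have := stdPdf_pos (|a - t| + 1); positivity) hN0.le (by linarith)
    (lt_min one_pos (by positivity)) fun c hc hc0 => ?_) (not_le.2 hNM)
  rw [lt_min_iff, lt_div_iff₀ (by positivity)] at hc0
  have hcc : c ^ 2 < 1 := by nlinarith [hc0.1]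
  set ρ := Real.sqrt (1 - c ^ 2) with hρ
  have hρ2 : ρ ^ 2 + c ^ 2 = 1 := by rw [hρ, Real.sq_sqrt (by linarith)]; ring
  have hρ0 : 0 < ρ := Real.sqrt_pos.2 (by linarith)
  have hρ1 : ρ ≤ 1 := by nlinarith
  have h1 := biPhi_le_measure_of_separated (γ := stdGaussian (EuclideanSpace ℝ ι)) (by simp) hρ0 hc hρ2
    hK hK' hr hr'r ha hb (a' := a - t) (b' := b - t) (by linarith) (by linarith)
  have h2 := hCle r' ρ c hr'0.le hρ0.le hc hρ2
  have h3 : (1 - ρ) * (|a - t| + 1) ≤ ζ := by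
    have : 1 - ρ ≤ c := by nlinarith
    exact (mul_le_mul_of_nonneg_right this (by positivity)).trans hc0.2.le
  have h4 := le_biPhi (b := b - t) hζ0 hζ1 hρ1 hc hm.1.le (by linarith) h3
  rw [hθr] at h2 ⊢
  refine le_trans ?_ (h4.trans (h1.trans h2))
  have h5 : stdPdf (M / c + 1) ≤ stdPdf ((m + 2 * ζ) / c + 1) := by
    refine stdPdf_le_stdPdf ?_
    rw [abs_of_nonneg (by have := hm.1; positivity)]
    gcongr
  have h6 : stdPdf (M / c + 1) = (Real.sqrt (2 * Real.pi))⁻¹ * Real.exp (-((M / c + 1) ^ 2 / 2)) := by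
    rw [stdPdf, neg_div]
  calc _ = ζ * (stdPdf (|a - t| + 1) * stdPdf (M / c + 1)) := by rw [h6]; ring
    _ ≤ _ := by
      have := stdPdf_pos (|a - t| + 1)
      gcongr

/-- The Gaussian isoperimetric inequality for sets of measure at least one half. -/
theorem stdPhi_le_measure_cthickening {ι : Type*} [Fintype ι] {A : Set (EuclideanSpace ℝ ι)}
    (hA : MeasurableSet A) (hA2 : 1 / 2 ≤ (stdGaussian (EuclideanSpace ℝ ι)).real A) {r : ℝ}
    (hr : 0 < r) : stdPhi r ≤ (stdGaussian (EuclideanSpace ℝ ι)).real (Metric.cthickening r A) := by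
  set γ := stdGaussian (EuclideanSpace ℝ ι)
  by_contra! hlt
  have hcl : MeasurableSet (Metric.cthickening r A) := Metric.isClosed_cthickening.measurableSet
  have hB : stdPhi (-r) < γ.real (Metric.cthickening r A)ᶜ := by
    rw [probReal_compl_eq_one_sub hcl, stdPhi_neg]
    linarith
  obtain ⟨e, he, heB⟩ : ∃ e : ℝ, 0 < e ∧ stdPhi (-r + 2 * e) < γ.real (Metric.cthickening r A)ᶜ := by
    have h1 : Tendsto (fun e : ℝ => stdPhi (-r + 2 * e)) (𝓝[>] 0) (𝓝 (stdPhi (-r))) := by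
      have : Continuous fun e : ℝ => stdPhi (-r + 2 * e) := continuous_stdPhi.comp (by fun_prop)
      simpa using (this.tendsto 0).mono_left nhdsWithin_le_nhds
    obtain ⟨e, h2, h3⟩ := ((h1.eventually_lt_const hB).and self_mem_nhdsWithin).exists
    exact ⟨e, h3, h2⟩
  have hA' : stdPhi (-e) < γ.real A := by
    have := strictMono_stdPhi (show -e < 0 by linarith)
    rw [stdPhi_zero] at this
    linarith
  have key : ∀ {S : Set (EuclideanSpace ℝ ι)} {u : ℝ}, MeasurableSet S → stdPhi u < γ.real S →
      ∃ K ⊆ S, IsCompact K ∧ stdPhi u ≤ γ.real K := by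
    intro S u hS h
    rw [Measure.real, ← ENNReal.ofReal_lt_iff_lt_toReal (stdPhi_nonneg _) (measure_ne_top _ _)] at h
    obtain ⟨K, hKS, hK, hKu⟩ := hS.exists_lt_isCompact_of_ne_top (measure_ne_top _ _) h
    refine ⟨K, hKS, hK, ?_⟩
    rw [ENNReal.ofReal_lt_iff_lt_toReal (stdPhi_nonneg _) (measure_ne_top _ _)] at hKu
    exact hKu.le
  obtain ⟨K, hKA, hK, hKa⟩ := key hA hA'
  obtain ⟨K', hKB, hK', hKb⟩ := key hcl.compl heB
  have := add_le_neg_of_separated hK hK' hr (fun x hx y hy => ?_) hKa hKb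
  · linarith
  · by_contra! hxy
    refine hKB hy (Metric.mem_cthickening_of_dist_le y x r A (hKA hx) ?_)
    rw [dist_comm, dist_eq_norm]
    exact hxy.le

/-- An upper bound for the Mills ratio, from the continued fraction of the Gaussian tail. -/
lemma stdPhi_neg_le_stdPdf_mul {t : ℝ} (ht : 0 < t) :
    stdPhi (-t) ≤ stdPdf t * ((t ^ 4 + 9 * t ^ 2 + 8) / (t ^ 5 + 10 * t ^ 3 + 15 * t)) := by
  set G : ℝ → ℝ := fun s => stdPhi s +
    stdPdf s * ((s ^ 4 + 9 * s ^ 2 + 8) / (s ^ 5 + 10 * s ^ 3 + 15 * s)) with hG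
  have hD : ∀ s : ℝ, 0 < s → 0 < s ^ 5 + 10 * s ^ 3 + 15 * s := fun s hs => by positivity
  have hd : ∀ s : ℝ, 0 < s → HasDerivAt G
      (-(stdPdf s * (120 / (s ^ 5 + 10 * s ^ 3 + 15 * s) ^ 2))) s := by
    intro s hs
    have h1 : HasDerivAt (fun s : ℝ => s ^ 4 + 9 * s ^ 2 + 8) (4 * s ^ 3 + 9 * (2 * s)) s := by
      have := (((hasDerivAt_pow 4 s).add ((hasDerivAt_pow 2 s).const_mul 9)).add_const 8)
      simpa using this
    have h2 : HasDerivAt (fun s : ℝ => s ^ 5 + 10 * s ^ 3 + 15 * s)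
        (5 * s ^ 4 + 10 * (3 * s ^ 2) + 15) s := by
      have := ((hasDerivAt_pow 5 s).add ((hasDerivAt_pow 3 s).const_mul 10)).add
        ((hasDerivAt_id s).const_mul 15)
      exact this.congr_deriv (by simp)
    refine ((hasDerivAt_stdPhi s).add ((hasDerivAt_stdPdf s).mul (h1.div h2 (hD s hs).ne'))).congr_deriv ?_
    have := (hD s hs).ne'
    simp only [Pi.div_apply]
    field_simp
    ring
  have hanti : AntitoneOn G (Ici t) := by
    refine antitoneOn_of_deriv_nonpos (convex_Ici t)
      (fun s hs => (hd s (ht.trans_le hs)).continuousAt.continuousWithinAt)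
      (fun s hs => (hd s (ht.trans_le (interior_subset hs))).differentiableAt.differentiableWithinAt) fun s hs => ?_
    rw [(hd s (ht.trans_le (interior_subset hs))).deriv]
    have := stdPdf_pos s
    have : 0 ≤ stdPdf s * (120 / (s ^ 5 + 10 * s ^ 3 + 15 * s) ^ 2) := by positivity
    linarith
  have hle : 1 ≤ G t := by
    refine le_of_tendsto tendsto_stdPhi_atTop ?_
    filter_upwards [eventually_ge_atTop t] with s hs
    refine le_trans ?_ (hanti self_mem_Ici hs hs)
    have := stdPdf_pos s
    have := hD s (ht.trans_le hs)
    have : 0 ≤ stdPdf s * ((s ^ 4 + 9 * s ^ 2 + 8) / (s ^ 5 + 10 * s ^ 3 + 15 * s)) := by positivity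
    simp only [hG]
    linarith
  rw [stdPhi_neg]
  simp only [hG] at hle
  linarith

lemma stdPhi_neg_le_exp {t : ℝ} (ht : 1.177 ≤ t) : stdPhi (-t) ≤ Real.exp (-(t ^ 2) / 2) / 4 := by
  have ht0 : 0 < t := by linarith
  refine (stdPhi_neg_le_stdPdf_mul ht0).trans ?_
  have hpi : 2.506 ≤ Real.sqrt (2 * Real.pi) := by
    refine Real.le_sqrt_of_sq_le ?_
    nlinarith [Real.pi_gt_d4]
  have h1 : 4 * (t ^ 4 + 9 * t ^ 2 + 8) ≤ 2.506 * (t ^ 5 + 10 * t ^ 3 + 15 * t) := by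
    obtain ⟨u, rfl⟩ : ∃ u, t = 1.177 + u := ⟨t - 1.177, by ring⟩
    have hu : 0 ≤ u := by linarith
    rw [← sub_nonneg]
    ring_nf
    positivity
  have hD : 0 < t ^ 5 + 10 * t ^ 3 + 15 * t := by positivity
  have hs : 0 < Real.sqrt (2 * Real.pi) := by linarith
  rw [stdPdf, mul_assoc, mul_div_assoc', inv_mul_eq_div, div_div, div_le_div_iff₀ (by positivity) (by norm_num),
    mul_assoc]
  refine mul_le_mul_of_nonneg_left ?_ (Real.exp_pos _).le
  nlinarith

section UnionBound

variable {E : Type*} [NormedAddCommGroup E] [InnerProductSpace ℝ E] [FiniteDimensional ℝ E]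
  [MeasurableSpace E] [BorelSpace E]

lemma stdGaussian_abs_dual_gt_le {L : E →L[ℝ] ℝ} (hL : ‖L‖ ≤ 1) {T : ℝ} :
    (stdGaussian E).real {z | T < |L z|} ≤ 2 * stdPhi (-T) := by
  have hm : MeasurableSet {x : ℝ | T < |x|} := measurableSet_lt (by fun_prop) (by fun_prop)
  have hmap : (stdGaussian E).map L = (gaussianReal 0 1).map (fun x => ‖L‖ * x) := by
    rw [IsGaussian.map_eq_gaussianReal, integral_strongDual_stdGaussian, variance_dual_stdGaussian,
      gaussianReal_map_const_mul]
    congr 1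
    · simp
    · ext; simp
  have h1 : (stdGaussian E).real {z | T < |L z|} = (gaussianReal 0 1).real {x | T < |‖L‖ * x|} := by
    change (stdGaussian E).real (L ⁻¹' {x | T < |x|}) = (gaussianReal 0 1).real ((fun x => ‖L‖ * x) ⁻¹' {x | T < |x|})
    rw [← map_measureReal_apply (by fun_prop) hm, hmap, map_measureReal_apply (by fun_prop) hm]
  have h2 : {x : ℝ | T < |‖L‖ * x|} ⊆ Iic (-T) ∪ (Iic T)ᶜ := by
    intro x hx
    have hx' : T < |‖L‖ * x| := hx
    rw [abs_mul, abs_of_nonneg (norm_nonneg L)] at hx'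
    have h3 : T < |x| := hx'.trans_le (mul_le_of_le_one_left (abs_nonneg x) hL)
    rcases lt_abs.1 h3 with h | h
    · exact Or.inr (by simpa using h)
    · exact Or.inl (by simp only [mem_Iic]; linarith)
  have h3 : (gaussianReal 0 1).real (Iic (-T)) = stdPhi (-T) := rfl
  have h4 : (gaussianReal 0 1).real (Iic T)ᶜ = stdPhi (-T) := by
    rw [probReal_compl_eq_one_sub measurableSet_Iic, stdPhi_neg]
    rfl
  rw [h1]
  refine (measureReal_mono h2).trans ((measureReal_union_le _ _).trans ?_)
  rw [h3, h4]
  linarith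

lemma half_le_stdGaussian_forall_abs_le {p : ℕ} (hp : 2 ≤ p) {L : Fin p → E →L[ℝ] ℝ}
    (hL : ∀ j, ‖L j‖ ≤ 1) :
    1 / 2 ≤ (stdGaussian E).real {z | ∀ j, |L j z| ≤ Real.sqrt (2 * Real.log p)} := by
  set T := Real.sqrt (2 * Real.log p)
  have hp' : (2 : ℝ) ≤ p := by exact_mod_cast hp
  have hlog : Real.log 2 ≤ Real.log p := Real.log_le_log (by norm_num) hp'
  have hT2 : T ^ 2 = 2 * Real.log p := Real.sq_sqrt (by have := Real.log_two_gt_d9; linarith)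
  have hT : 1.177 ≤ T := Real.le_sqrt_of_sq_le (by have := Real.log_two_gt_d9; norm_num at *; linarith)
  have hQ : stdPhi (-T) ≤ 1 / (4 * p) := by
    refine (stdPhi_neg_le_exp hT).trans_eq ?_
    rw [hT2, neg_div, mul_div_cancel_left₀ _ (by norm_num), Real.exp_neg, Real.exp_log (by linarith)]
    field_simp
  have hm : MeasurableSet {z : E | ∀ j, |L j z| ≤ T} := by
    simp only [ofPred_forall]
    exact MeasurableSet.iInter fun j => measurableSet_le (by fun_prop) (by fun_prop)
  have hc : {z : E | ∀ j, |L j z| ≤ T}ᶜ = ⋃ j, {z | T < |L j z|} := by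
    ext z
    simp
  have h1 : (stdGaussian E).real {z : E | ∀ j, |L j z| ≤ T}ᶜ ≤ 1 / 2 := by
    rw [hc]
    calc _ ≤ ∑ j : Fin p, (stdGaussian E).real {z | T < |L j z|} := measureReal_iUnion_fintype_le _
      _ ≤ ∑ j : Fin p, 2 * (1 / (4 * (p : ℝ))) := by
          refine Finset.sum_le_sum fun j _ => (stdGaussian_abs_dual_gt_le (hL j)).trans ?_
          gcongr
      _ = 1 / 2 := by
          rw [Finset.sum_const, Finset.card_univ, Fintype.card_fin, nsmul_eq_mul]
          field_simp
          norm_num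
  rw [probReal_compl_eq_one_sub hm] at h1
  linarith

end UnionBound

lemma scaledNorm_nonneg {n : ℕ} (u : Fin n → ℝ) : 0 ≤ scaledNorm u := Real.sqrt_nonneg _

lemma scaledNorm_sq {n : ℕ} (u : Fin n → ℝ) : scaledNorm u ^ 2 = (u ⬝ᵥ u) / n := by
  rw [scaledNorm, Real.sq_sqrt (by positivity)]
  simp [dotProduct, sq]

lemma scaledNorm_eq_norm {n : ℕ} (u : Fin n → ℝ) :
    scaledNorm u = ‖WithLp.toLp 2 u‖ / Real.sqrt n := by
  rw [scaledNorm, EuclideanSpace.norm_eq, Real.sqrt_div' _ (Nat.cast_nonneg n)]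
  simp

lemma scaledNorm_add_le {n : ℕ} (u v : Fin n → ℝ) :
    scaledNorm (u + v) ≤ scaledNorm u + scaledNorm v := by
  simp only [scaledNorm_eq_norm, ← add_div, WithLp.toLp_add]
  gcongr
  exact norm_add_le _ _

lemma dotProduct_div_le_scaledNorm_mul {n : ℕ} (u v : Fin n → ℝ) :
    (u ⬝ᵥ v) / n ≤ scaledNorm u * scaledNorm v := by
  have h : u ⬝ᵥ v ≤ ‖WithLp.toLp 2 u‖ * ‖WithLp.toLp 2 v‖ := by
    have := real_inner_le_norm (WithLp.toLp 2 u) (WithLp.toLp 2 v)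
    rwa [EuclideanSpace.inner_toLp_toLp, star_trivial, dotProduct_comm] at this
  rw [scaledNorm_eq_norm, scaledNorm_eq_norm, div_mul_div_comm,
    Real.mul_self_sqrt (Nat.cast_nonneg n)]
  gcongr

/-- `a` minimizes the LASSO objective `‖y - Xb‖² + 2λ|b|₁`. -/
def IsLassoSolution {n p : ℕ} (X : Matrix (Fin n) (Fin p) ℝ) (lam : ℝ) (y : Fin n → ℝ)
    (a : Fin p → ℝ) : Prop :=
  ∀ b : Fin p → ℝ, scaledNorm (y - X.mulVec a) ^ 2 + 2 * lam * ∑ j, |a j|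
    ≤ scaledNorm (y - X.mulVec b) ^ 2 + 2 * lam * ∑ j, |b j|

namespace IsLassoSolution

variable {n p : ℕ} {X : Matrix (Fin n) (Fin p) ℝ} {lam : ℝ}

lemma dotProduct_div_le {y : Fin n → ℝ} {a : Fin p → ℝ} (h : IsLassoSolution X lam y a)
    (hlam : 0 ≤ lam) (b : Fin p → ℝ) :
    ((y - X.mulVec a) ⬝ᵥ X.mulVec (b - a)) / n ≤ lam * (∑ j, |b j| - ∑ j, |a j|) := by
  set r := y - X.mulVec a with hr
  set w := X.mulVec (b - a) with hw
  have key : ∀ t ∈ Ioc (0 : ℝ) 1, 2 * ((r ⬝ᵥ w) / n) - 2 * (lam * (∑ j, |b j| - ∑ j, |a j|))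
      ≤ t * ((w ⬝ᵥ w) / n) := by
    rintro t ⟨ht0, ht1⟩
    have h1 := h (a + t • (b - a))
    have h2 : y - X.mulVec (a + t • (b - a)) = r - t • w := by
      rw [Matrix.mulVec_add, Matrix.mulVec_smul, hr, hw, sub_sub]
    have h3 : ∑ j, |(a + t • (b - a)) j| ≤ (1 - t) * ∑ j, |a j| + t * ∑ j, |b j| := by
      rw [Finset.mul_sum, Finset.mul_sum, ← Finset.sum_add_distrib]
      refine Finset.sum_le_sum fun j _ => ?_
      have : (a + t • (b - a)) j = (1 - t) * a j + t * b j := by simp; ring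
      rw [this]
      refine (abs_add_le _ _).trans_eq ?_
      rw [abs_mul, abs_mul, abs_of_nonneg (by linarith : 0 ≤ 1 - t), abs_of_pos ht0]
    rw [h2, ← hr, scaledNorm_sq, scaledNorm_sq] at h1
    have h4 : (r - t • w) ⬝ᵥ (r - t • w) / (n : ℝ)
        = (r ⬝ᵥ r) / n - 2 * t * ((r ⬝ᵥ w) / n) + t * (t * ((w ⬝ᵥ w) / n)) := by
      simp only [sub_dotProduct, dotProduct_sub, smul_dotProduct, dotProduct_smul, smul_eq_mul,
        dotProduct_comm w r]
      ring
    rw [h4] at h1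
    have h5 := mul_le_mul_of_nonneg_left h3 hlam
    refine le_of_mul_le_mul_left ?_ ht0
    linarith
  have hlim : Tendsto (fun t : ℝ => t * ((w ⬝ᵥ w) / n)) (𝓝[>] 0) (𝓝 0) := by
    have : Tendsto (fun t : ℝ => t * ((w ⬝ᵥ w) / n)) (𝓝 0) (𝓝 (0 * ((w ⬝ᵥ w) / n))) :=
      Continuous.tendsto (by fun_prop) 0
    rw [zero_mul] at this
    exact this.mono_left nhdsWithin_le_nhds
  have := ge_of_tendsto hlim (Filter.mem_of_superset (Ioc_mem_nhdsGT zero_lt_one) key)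
  linarith

lemma scaledNorm_mulVec_sub_le {y y' : Fin n → ℝ} {a a' : Fin p → ℝ}
    (h : IsLassoSolution X lam y a) (h' : IsLassoSolution X lam y' a') (hlam : 0 ≤ lam) :
    scaledNorm (X.mulVec (a' - a)) ≤ scaledNorm (y' - y) := by
  have h1 := h.dotProduct_div_le hlam a'
  have h2 := h'.dotProduct_div_le hlam a
  have h3 : X.mulVec (a - a') = - X.mulVec (a' - a) := by rw [← Matrix.mulVec_neg, neg_sub]
  have h4 : scaledNorm (X.mulVec (a' - a)) ^ 2
      ≤ scaledNorm (y' - y) * scaledNorm (X.mulVec (a' - a)) := by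
    refine le_trans ?_ (dotProduct_div_le_scaledNorm_mul _ _)
    rw [scaledNorm_sq]
    rw [h3] at h2
    have h5 : (X.mulVec (a' - a) ⬝ᵥ X.mulVec (a' - a)) / (n : ℝ)
        = ((y - X.mulVec a) ⬝ᵥ X.mulVec (a' - a)) / n
          + ((y' - X.mulVec a') ⬝ᵥ (-X.mulVec (a' - a))) / n
          + ((y' - y) ⬝ᵥ X.mulVec (a' - a)) / n := by
      rw [← add_div, ← add_div, dotProduct_neg, ← sub_eq_add_neg, ← sub_dotProduct,
        ← add_dotProduct]
      congr 2
      rw [Matrix.mulVec_sub]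
      abel
    linarith
  rw [sq] at h4
  rcases (scaledNorm_nonneg (X.mulVec (a' - a))).eq_or_lt with h0 | h0
  · rw [← h0]
    exact scaledNorm_nonneg _
  · exact le_of_mul_le_mul_right h4 h0

/-- Sharp basic inequality on the event where the noise is dominated by the penalty. -/
lemma sq_add_sq_le {f ξ : Fin n → ℝ} {a : Fin p → ℝ} (h : IsLassoSolution X lam (f + ξ) a)
    (hlam : 0 ≤ lam) (hξ : ∀ j, |(∑ i, X i j * ξ i) / n| ≤ lam / 2) {S : Finset (Fin p)}
    {β : Fin p → ℝ} (hβ : Function.support β = ↑S) :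
    scaledNorm (X.mulVec a - f) ^ 2 + scaledNorm (X.mulVec (a - β)) ^ 2
      ≤ scaledNorm (X.mulVec β - f) ^ 2 + 3 * lam * ∑ j ∈ S, |(a - β) j|
        - lam * ∑ j ∈ Sᶜ, |(a - β) j| := by
  have h1 := h.dotProduct_div_le hlam β
  have h2 : ∑ j, |β j| - ∑ j, |a j| ≤ ∑ j ∈ S, |(a - β) j| - ∑ j ∈ Sᶜ, |(a - β) j| := by
    rw [← Finset.sum_add_sum_compl S fun j => |β j|, ← Finset.sum_add_sum_compl S fun j => |a j|]
    have h3 : ∀ j ∈ Sᶜ, β j = 0 := fun j hj => by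
      by_contra hne
      have : j ∈ (S : Set (Fin p)) := hβ ▸ hne
      simp_all
    have h4 : ∑ j ∈ Sᶜ, |β j| = 0 := Finset.sum_eq_zero fun j hj => by rw [h3 j hj, abs_zero]
    have h5 : ∑ j ∈ Sᶜ, |(a - β) j| = ∑ j ∈ Sᶜ, |a j| :=
      Finset.sum_congr rfl fun j hj => by simp [h3 j hj]
    have h6 : ∑ j ∈ S, |β j| - ∑ j ∈ S, |a j| ≤ ∑ j ∈ S, |(a - β) j| := by
      rw [← Finset.sum_sub_distrib]
      refine Finset.sum_le_sum fun j _ => ?_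
      rw [Pi.sub_apply, abs_sub_comm]
      exact abs_sub_abs_le_abs_sub _ _
    linarith
  have h3 : (ξ ⬝ᵥ X.mulVec (a - β)) / n ≤ lam / 2 * ∑ j, |(a - β) j| := by
    have : (ξ ⬝ᵥ X.mulVec (a - β)) / n = ∑ j, ((∑ i, X i j * ξ i) / n) * (a - β) j := by
      rw [Matrix.dotProduct_mulVec, dotProduct, Finset.sum_div]
      refine Finset.sum_congr rfl fun j _ => ?_
      rw [Matrix.vecMul, dotProduct, mul_div_right_comm]
      simp only [mul_comm]
    rw [this, Finset.mul_sum]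
    refine Finset.sum_le_sum fun j _ => (le_abs_self _).trans ?_
    rw [abs_mul]
    exact mul_le_mul_of_nonneg_right (hξ j) (abs_nonneg _)
  rw [← Finset.sum_add_sum_compl S fun j => |(a - β) j|] at h3
  have h4 : X.mulVec (β - a) = - X.mulVec (a - β) := by rw [← Matrix.mulVec_neg, neg_sub]
  have h5 : X.mulVec β - f = (X.mulVec a - f) - X.mulVec (a - β) := by
    rw [Matrix.mulVec_sub]
    abel
  have h6 : f + ξ - X.mulVec a = ξ - (X.mulVec a - f) := by abel
  rw [h4, h6] at h1
  have h7 := mul_le_mul_of_nonneg_left h2 hlam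
  rw [h5, scaledNorm_sq, scaledNorm_sq, scaledNorm_sq]
  generalize X.mulVec a - f = u at *
  generalize X.mulVec (a - β) = w at *
  simp only [sub_dotProduct, dotProduct_sub, dotProduct_neg, dotProduct_comm w u, sub_div,
    neg_div] at *
  linarith

lemma kappaSq_mul_le {S : Finset (Fin p)} {Δ : Fin p → ℝ}
    (hΔ : ∑ j ∈ Sᶜ, |Δ j| ≤ 3 * ∑ j ∈ S, |Δ j|) :
    kappaSq X S 3 * ∑ j, Δ j ^ 2 ≤ scaledNorm (X.mulVec Δ) ^ 2 := by
  by_cases h0 : Δ = 0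
  · simp [h0, sq_nonneg]
  have hpos : 0 < ∑ j, Δ j ^ 2 := by
    obtain ⟨j, hj⟩ := Function.ne_iff.1 h0
    exact Finset.sum_pos' (fun j _ => sq_nonneg _) ⟨j, Finset.mem_univ j, by
      have : Δ j ≠ 0 := hj
      positivity⟩
  rw [← le_div_iff₀ hpos]
  refine csInf_le ⟨0, ?_⟩ ⟨Δ, h0, hΔ, rfl⟩
  rintro _ ⟨Δ', _, _, rfl⟩
  positivity

/-- Deterministic oracle inequality. -/
lemma ofReal_scaledNorm_le {f ξ : Fin n → ℝ} {a : Fin p → ℝ}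
    (h : IsLassoSolution X lam (f + ξ) a)
    (hlam : 0 < lam) (hξ : ∀ j, |(∑ i, X i j * ξ i) / n| ≤ lam / 2) {S : Finset (Fin p)}
    {β : Fin p → ℝ} (hβ : Function.support β = ↑S) :
    ENNReal.ofReal (scaledNorm (X.mulVec a - f)) ≤ ENNReal.ofReal (scaledNorm (X.mulVec β - f)) +
      ENNReal.ofReal (3 * lam * Real.sqrt S.card) /
        ENNReal.ofReal (2 * Real.sqrt (kappaSq X S 3)) := by
  have hb := h.sq_add_sq_le hlam.le hξ hβ
  set u := scaledNorm (X.mulVec a - f)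
  set v := scaledNorm (X.mulVec β - f)
  set w := scaledNorm (X.mulVec (a - β))
  have hv : 0 ≤ v := scaledNorm_nonneg _
  by_cases hcone : ∑ j ∈ Sᶜ, |(a - β) j| ≤ 3 * ∑ j ∈ S, |(a - β) j|
  swap
  · refine le_add_right (ENNReal.ofReal_le_ofReal (abs_le_of_sq_le_sq' ?_ hv).2)
    nlinarith [sq_nonneg w]
  rcases S.eq_empty_or_nonempty with hS | hS
  · refine le_add_right (ENNReal.ofReal_le_ofReal (abs_le_of_sq_le_sq' ?_ hv).2)
    have h0 : ∑ j ∈ S, |(a - β) j| = 0 := by simp [hS]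
    have h1 : 0 ≤ lam * ∑ j ∈ Sᶜ, |(a - β) j| :=
      mul_nonneg hlam.le (Finset.sum_nonneg fun _ _ => abs_nonneg _)
    rw [h0] at hb
    nlinarith [sq_nonneg w]
  have hs : 0 < Real.sqrt S.card := by
    rw [Real.sqrt_pos]
    exact_mod_cast hS.card_pos
  rcases (Real.sqrt_nonneg (kappaSq X S 3)).eq_or_lt with hk | hk
  · rw [← hk, mul_zero, ENNReal.ofReal_zero, ENNReal.div_zero, add_top]
    · exact le_top
    · rw [Ne, ENNReal.ofReal_eq_zero, not_le]
      positivity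
  rw [← ENNReal.ofReal_div_of_pos (by positivity), ← ENNReal.ofReal_add hv (by positivity)]
  refine ENNReal.ofReal_le_ofReal (abs_le_of_sq_le_sq' ?_ (by positivity)).2
  set k := Real.sqrt (kappaSq X S 3)
  have hk2 : k ^ 2 = kappaSq X S 3 := Real.sq_sqrt (Real.sqrt_pos.1 hk).le
  have hκ := kappaSq_mul_le (X := X) hcone
  have hl1 : (∑ j ∈ S, |(a - β) j|) ^ 2 ≤ S.card * ∑ j, (a - β) j ^ 2 := by
    refine sq_sum_le_card_mul_sum_sq.trans ?_
    simp only [sq_abs]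
    gcongr
    exact Finset.subset_univ _
  set d := ∑ j ∈ S, |(a - β) j|
  have hd0 : 0 ≤ lam * ∑ j ∈ Sᶜ, |(a - β) j| :=
    mul_nonneg hlam.le (Finset.sum_nonneg fun _ _ => abs_nonneg _)
  have hs2 : Real.sqrt S.card ^ 2 = S.card := Real.sq_sqrt (Nat.cast_nonneg _)
  have hd : k * d ≤ Real.sqrt S.card * w := by
    refine (abs_le_of_sq_le_sq' ?_ (mul_nonneg hs.le (scaledNorm_nonneg _))).2
    calc (k * d) ^ 2 = k ^ 2 * d ^ 2 := by ring
      _ ≤ k ^ 2 * (S.card * ∑ j, (a - β) j ^ 2) := by gcongr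
      _ = S.card * (kappaSq X S 3 * ∑ j, (a - β) j ^ 2) := by rw [hk2]; ring
      _ ≤ S.card * w ^ 2 := by gcongr
      _ = (Real.sqrt S.card * w) ^ 2 := by rw [mul_pow, hs2]
  set c := 3 * lam * Real.sqrt S.card / (2 * k) with hc
  have hc0 : 0 ≤ c := by positivity
  have h3 : 3 * lam * d ≤ 2 * c * w := by
    have : d ≤ Real.sqrt S.card * w / k := by
      rw [le_div_iff₀ hk, mul_comm]
      exact hd
    calc 3 * lam * d ≤ 3 * lam * (Real.sqrt S.card * w / k) := by gcongr
      _ = 2 * c * w := by rw [hc]; field_simp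
  nlinarith [sq_nonneg (c - w), mul_nonneg hv hc0]

/-- Oracle inequality for noise vectors close to a noise vector dominated by the penalty. -/
lemma ofReal_scaledNorm_le_iInf_add {f ξ ξ₀ : Fin n → ℝ} {a a₀ : Fin p → ℝ}
    (h : IsLassoSolution X lam (f + ξ) a) (h₀ : IsLassoSolution X lam (f + ξ₀) a₀)
    (hlam : 0 < lam) (hξ : ∀ j, |(∑ i, X i j * ξ₀ i) / n| ≤ lam / 2) :
    ENNReal.ofReal (scaledNorm (X.mulVec a - f)) ≤
      (⨅ (S : Finset (Fin p)) (β : Fin p → ℝ) (_ : Function.support β = ↑S),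
        (ENNReal.ofReal (scaledNorm (X.mulVec β - f)) +
          ENNReal.ofReal (3 * lam * Real.sqrt S.card) /
            ENNReal.ofReal (2 * Real.sqrt (kappaSq X S 3)))) +
        ENNReal.ofReal (scaledNorm (ξ - ξ₀)) := by
  have h1 : scaledNorm (X.mulVec a - f) ≤ scaledNorm (X.mulVec a₀ - f) + scaledNorm (ξ - ξ₀) := by
    have h2 := h₀.scaledNorm_mulVec_sub_le h hlam.le
    rw [add_sub_add_left_eq_sub] at h2
    have h3 : X.mulVec a - f = (X.mulVec a₀ - f) + X.mulVec (a - a₀) := by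
      rw [Matrix.mulVec_sub]
      abel
    rw [h3]
    exact (scaledNorm_add_le _ _).trans (by gcongr)
  refine (ENNReal.ofReal_le_ofReal h1).trans ?_
  rw [ENNReal.ofReal_add (scaledNorm_nonneg _) (scaledNorm_nonneg _)]
  gcongr
  exact le_iInf fun S => le_iInf fun β => le_iInf fun hβ => h₀.ofReal_scaledNorm_le hlam hξ hβ

end IsLassoSolution

lemma gaussianVec_eq_map_stdGaussian (n : ℕ) (σ : ℝ) :
    gaussianVec n σ = (stdGaussian (EuclideanSpace ℝ (Fin n))).map (fun z => σ • z.ofLp) := by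
  rw [← map_pi_eq_stdGaussian, Measure.map_map (by fun_prop) (by fun_prop)]
  have h : gaussianReal 0 ⟨σ ^ 2, sq_nonneg σ⟩ = (gaussianReal 0 1).map (fun x => σ * x) := by
    rw [gaussianReal_map_const_mul, mul_zero, mul_one]
    rfl
  rw [gaussianVec, h, ← Measure.pi_map_pi (fun _ => by fun_prop)]
  rfl

lemma norm_smul_innerSL_toLp_le {n : ℕ} {x : Fin n → ℝ}
    (hx : (1 / n) * ∑ i, x i ^ 2 ≤ 1) :
    ‖(Real.sqrt n)⁻¹ • innerSL ℝ (WithLp.toLp 2 x)‖ ≤ 1 := by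
  have h : scaledNorm x ≤ 1 := by
    rw [scaledNorm, Real.sqrt_le_iff, one_pow, ← one_div_mul_eq_div]
    exact ⟨zero_le_one, hx⟩
  rw [norm_smul, innerSL_apply_norm, norm_inv, Real.norm_of_nonneg (Real.sqrt_nonneg _),
    inv_mul_eq_div, ← scaledNorm_eq_norm]
  exact h

/-- Gaussian concentration for a set of measure at least `1/2`, for an arbitrary Gaussian quantile:
some enlargement by the positive part of `q` has measure at least `Φ(q)`. -/
lemma stdPhi_le_measure_cthickening_max {ι : Type*} [Fintype ι] {A : Set (EuclideanSpace ℝ ι)}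
    (hA : MeasurableSet A) (hA2 : 1 / 2 ≤ (stdGaussian (EuclideanSpace ℝ ι)).real A) (q : ℝ) :
    stdPhi q ≤ (stdGaussian (EuclideanSpace ℝ ι)).real (Metric.cthickening (max q 0) A) := by
  rcases lt_or_ge 0 q with h | h
  · rw [max_eq_left h.le]
    exact stdPhi_le_measure_cthickening hA hA2 h
  · calc stdPhi q ≤ stdPhi 0 := strictMono_stdPhi.monotone h
      _ = 1 / 2 := stdPhi_zero
      _ ≤ _ := hA2
      _ ≤ _ := measureReal_mono (Metric.self_subset_cthickening A)

/-- Oracle inequality in probability for the LASSO, at any confidence level `1 - δ`.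
Here `q = Φ⁻¹(1-δ)` and the oracle bound (with the convention `a/0 = +∞`) is in `ℝ≥0∞`. -/
theorem stmt8 (n p : ℕ) (hn : 0 < n) (hp : 2 ≤ p) (σ : ℝ) (hσ : 0 < σ)
    (f : Fin n → ℝ) (X : Matrix (Fin n) (Fin p) ℝ)
    (hdiag : ∀ j : Fin p, (1 / n) * ∑ i, X i j ^ 2 ≤ 1)
    (lam : ℝ) (hlam : 2 * σ * Real.sqrt (2 * Real.log p / n) ≤ lam)
    (βhat : (Fin n → ℝ) → (Fin p → ℝ))
    (hmin : ∀ (y : Fin n → ℝ) (b : Fin p → ℝ),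
      scaledNorm (y - X.mulVec (βhat y)) ^ 2 + 2 * lam * ∑ j, |βhat y j|
        ≤ scaledNorm (y - X.mulVec b) ^ 2 + 2 * lam * ∑ j, |b j|)
    (δ : ℝ) (hδ0 : 0 < δ) (hδ1 : δ < 1)
    (q : ℝ) (hq : stdPhi q = 1 - δ) :
    gaussianVec n σ
        {ξ | ENNReal.ofReal (scaledNorm (X.mulVec (βhat (f + ξ)) - f))
          ≤ (⨅ (S : Finset (Fin p)) (β : Fin p → ℝ) (_ : Function.support β = ↑S),
              (ENNReal.ofReal (scaledNorm (X.mulVec β - f)) +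
                ENNReal.ofReal (3 * lam * Real.sqrt S.card) /
                  ENNReal.ofReal (2 * Real.sqrt (kappaSq X S 3))))
            + ENNReal.ofReal (σ * q / Real.sqrt n)}
      ≥ 1 - ENNReal.ofReal δ := by
  set T := Real.sqrt (2 * Real.log p)
  set L : Fin p → EuclideanSpace ℝ (Fin n) →L[ℝ] ℝ := fun j =>
    (Real.sqrt n)⁻¹ • innerSL ℝ (WithLp.toLp 2 fun i => X i j) with hL
  set A : Set (EuclideanSpace ℝ (Fin n)) := {z | ∀ j, |L j z| ≤ T} with hA
  have hn' : (0 : ℝ) < n := by exact_mod_cast hn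
  have hsn : 0 < Real.sqrt n := Real.sqrt_pos.2 hn'
  have hp' : (1 : ℝ) < p := by exact_mod_cast hp
  have hlogp : 0 < Real.log p := Real.log_pos hp'
  have hlam0 : 0 < lam := lt_of_lt_of_le (by positivity) hlam
  have hAc : IsClosed A := by
    rw [hA, ofPred_forall]
    exact isClosed_iInter fun j => isClosed_le (by fun_prop) continuous_const
  have hA2 : 1 / 2 ≤ (stdGaussian (EuclideanSpace ℝ (Fin n))).real A :=
    half_le_stdGaussian_forall_abs_le hp fun j => norm_smul_innerSL_toLp_le (hdiag j)
  have hdom : ∀ z ∈ A, ∀ j, |(∑ i, X i j * (σ • z.ofLp) i) / n| ≤ lam / 2 := by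
    intro z hz j
    have h1 : (∑ i, X i j * (σ • z.ofLp) i) / n = σ / Real.sqrt n * L j z := by
      have h2 : L j z = (Real.sqrt n)⁻¹ * ∑ i, X i j * z i := by
        simp [hL, PiLp.inner_apply, mul_comm]
      have h3 : ∑ i, X i j * (σ • z.ofLp) i = σ * ∑ i, X i j * z i := by
        rw [Finset.mul_sum]
        exact Finset.sum_congr rfl fun i _ => by simp; ring
      rw [h2, h3]
      nth_rw 1 [← Real.mul_self_sqrt hn'.le]
      field_simp
    rw [h1, abs_mul, abs_of_pos (by positivity)]
    rw [Real.sqrt_div' _ hn'.le] at hlam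
    calc σ / Real.sqrt n * |L j z| ≤ σ / Real.sqrt n * T := by
          gcongr
          exact hz j
      _ = 2 * σ * (T / Real.sqrt n) / 2 := by ring
      _ ≤ lam / 2 := by gcongr
  rw [ge_iff_le, gaussianVec_eq_map_stdGaussian]
  calc 1 - ENNReal.ofReal δ = ENNReal.ofReal (stdPhi q) := by
        rw [hq, ENNReal.ofReal_sub _ hδ0.le, ENNReal.ofReal_one]
    _ ≤ ENNReal.ofReal ((stdGaussian (EuclideanSpace ℝ (Fin n))).real
          (Metric.cthickening (max q 0) A)) :=
        ENNReal.ofReal_le_ofReal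
          (stdPhi_le_measure_cthickening_max hAc.measurableSet hA2 q)
    _ = stdGaussian (EuclideanSpace ℝ (Fin n)) (Metric.cthickening (max q 0) A) :=
        ofReal_measureReal
    _ ≤ _ := measure_mono fun z hz => ?_
    _ ≤ _ := Measure.le_map_apply (by fun_prop) _
  rw [hAc.cthickening_eq_biUnion_closedBall (le_max_right _ _)] at hz
  obtain ⟨z₀, hz₀, hd⟩ := mem_iUnion₂.1 hz
  refine (IsLassoSolution.ofReal_scaledNorm_le_iInf_add (hmin (f + σ • z.ofLp))
    (hmin (f + σ • z₀.ofLp)) hlam0 (hdom z₀ hz₀)).trans ?_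
  gcongr _ + ?_
  have hdist : ‖z - z₀‖ ≤ max q 0 := by simpa [dist_eq_norm] using hd
  have h1 : scaledNorm (σ • z.ofLp - σ • z₀.ofLp) = σ * ‖z - z₀‖ / Real.sqrt n := by
    rw [← smul_sub, scaledNorm_eq_norm, WithLp.toLp_smul, norm_smul, Real.norm_of_nonneg hσ.le]
    rfl
  rw [h1]
  calc ENNReal.ofReal (σ * ‖z - z₀‖ / Real.sqrt n)
      ≤ ENNReal.ofReal (max (σ * q / Real.sqrt n) 0) := by
        refine ENNReal.ofReal_le_ofReal ?_
        calc σ * ‖z - z₀‖ / Real.sqrt n ≤ σ * max q 0 / Real.sqrt n := by gcongr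
          _ = max (σ * q / Real.sqrt n) 0 := by
            rw [mul_max_of_nonneg _ _ hσ.le, mul_zero, ← max_div_div_right hsn.le, zero_div]
    _ = ENNReal.ofReal (σ * q / Real.sqrt n) := by simp [ENNReal.ofReal_max]
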